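/- Suppose the α_i are pairwise distinct, each α_i is irreducible in Λ (not the sum of two nonzero elements of Λ), and for the field k and monomial term order ⪯ the toric ideal I_Λ has a Gröbner basis of degree 2. Then for every λ ∈ Λ and every integer i ≥ 0, the dimension over k of the λ-graded component Tor_i^{k[Λ]}(k,k)_λ equals the number of J′-non-stuttering J′-commuting equivalence classes of words of length i and content λ. -/

import Mathlib

open scoped Classical

noncomputable section

namespace ASG

variable {e n : ℕ}

/-- Ambient monoid `ℕ^e`. -/
abbrev M (e : ℕ) : Type := Fin e →₀ ℕ

/-- The affine semigroup `Λ` generated by `α 1, …, α n`. -/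
def sg (α : Fin n → M e) : AddSubmonoid (M e) :=
  AddSubmonoid.closure (Set.range α)

/-- The partial order on `Λ` : `μ ≤ ν` iff `ν - μ ∈ Λ`. -/
def sgLE (α : Fin n → M e) (μ ν : M e) : Prop := ∃ δ ∈ sg α, μ + δ = ν

/-- Strict version of the order on `Λ`. -/
def sgLT (α : Fin n → M e) (μ ν : M e) : Prop := sgLE α μ ν ∧ μ ≠ ν

/-- `deg λ` : the least `r` such that `λ` is a sum of `r` generators. -/
def deg (α : Fin n → M e) (l : M e) : ℕ :=
  sInf {r : ℕ | ∃ w : Fin r → Fin n, l = ∑ t, α (w t)}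

/-- Comparability in the poset `Λ`. -/
def cmp2 (α : Fin n → M e) (a b : M e) : Prop := sgLE α a b ∨ sgLE α b a

/-- Faces of the order complex `Δ(x,y)` of the open interval `(x,y)` in `Λ`:
finite chains of elements strictly between `x` and `y`. -/
def IsOFace (α : Fin n → M e) (x y : M e) (S : Finset (M e)) : Prop :=
  (∀ μ ∈ S, μ ∈ sg α ∧ sgLT α x μ ∧ sgLT α μ y) ∧
    (S : Set (M e)).Pairwise (cmp2 α)

/-- Faces with `m` vertices (i.e. of dimension `m - 1`). -/
def OFace (α : Fin n → M e) (x y : M e) (m : ℕ) : Type :=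
  { S : Finset (M e) // IsOFace α x y S ∧ S.card = m }

/-- The simplicial chain group with coefficients in `K` spanned by the faces
with `m` vertices (the augmented/reduced chain complex: for `m = 0` this is a
copy of `K` spanned by the empty face). -/
abbrev OC (K : Type) [Field K] (α : Fin n → M e) (x y : M e) (m : ℕ) : Type :=
  OFace α x y m →₀ K

/-- Deleting a vertex from a face. -/
def erasedOFace {α : Fin n → M e} {x y : M e} {m : ℕ} (S : OFace α x y m)
    (v : M e) (hv : v ∈ S.1) : OFace α x y (m - 1) :=
  ⟨S.1.erase v,
    ⟨fun μ hμ => S.2.1.1 μ (Finset.mem_of_mem_erase hμ),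
      S.2.1.2.mono (Finset.coe_subset.mpr (Finset.erase_subset _ _))⟩,
    by rw [Finset.card_erase_of_mem hv, S.2.2]⟩

/-- The simplicial boundary map of the (augmented) chain complex of `Δ(x,y)`;
the sign of the deletion of a vertex `v` is `(-1)^(number of vertices below v)`. -/
def obd (K : Type) [Field K] (α : Fin n → M e) (x y : M e) (m : ℕ) :
    OC K α x y m →ₗ[K] OC K α x y (m - 1) :=
  Finsupp.linearCombination K fun S : OFace α x y m =>
    ∑ v ∈ S.1.attach,
      ((-1 : K) ^ (S.1.filter fun w => sgLT α w v.1).card) •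
        Finsupp.single (erasedOFace S v.1 v.2) 1

/-- Vanishing of the reduced simplicial homology `H̃_i(Δ(x,y); K)`, for `i : ℤ`:
every reduced `i`-cycle is a boundary.  (An `i`-dimensional face has `i + 1`
vertices; for `i ≤ -2` the statement is vacuous, as is the reduced homology.) -/
def HredVanishes (K : Type) [Field K] (α : Fin n → M e) (x y : M e) (i : ℤ) : Prop :=
  ∀ m : ℕ, (m : ℤ) = i + 1 →
    ∀ c : OC K α x y m, obd K α x y m c = 0 →
      ∃ b : OC K α x y (m + 1), obd K α x y (m + 1) b = c

/-- The reduced simplicial homology group `H̃_(m-1)(Δ(x,y); K)` :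
cycles in the chain group spanned by faces with `m` vertices modulo boundaries,
realized as the image of the cycles in the cokernel of the boundary map. -/
abbrev HredMod (K : Type) [Field K] (α : Fin n → M e) (x y : M e) (m : ℕ) : Type :=
  ↥(Submodule.map (Submodule.mkQ (LinearMap.range (obd K α x y (m + 1))))
      (LinearMap.ker (obd K α x y m)))

end ASG
namespace ASG

variable {e n : ℕ}

/-- The toric ideal `I_Λ = ker φ ⊆ k[z_1, …, z_n]`, where
`φ(z_i) = x^(α i) ∈ k[Λ] ⊆ k[x_1, …, x_e]`. -/
def toricIdeal (k : Type) [Field k] (α : Fin n → M e) : Ideal (MvPolynomial (Fin n) k) :=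
  RingHom.ker (MvPolynomial.aeval (R := k)
    fun i : Fin n => (MvPolynomial.monomial (α i) 1 : MvPolynomial (Fin e) k))

/-- A monomial term order on `k[z_1, …, z_n]` (monomials identified with their
exponent vectors in `ℕ^n`): a linear order such that `1` is least and which is
compatible with multiplication of monomials. -/
def IsTermOrder (ord : LinearOrder (Fin n →₀ ℕ)) : Prop :=
  (∀ a, ord.le 0 a) ∧ ∀ a b c, ord.le a b → ord.le (a + c) (b + c)

/-- The initial ideal `in_⪯(I_Λ)`: the ideal generated by the `⪯`-leading
monomials of the nonzero elements of `I_Λ`. -/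
def initialIdeal (k : Type) [Field k] (ord : LinearOrder (Fin n →₀ ℕ)) (α : Fin n → M e) :
    Ideal (MvPolynomial (Fin n) k) :=
  Ideal.span {p | ∃ f ∈ toricIdeal k α, f ≠ 0 ∧ ∃ mo : Fin n →₀ ℕ,
    (mo ∈ f.support ∧ ∀ m' ∈ f.support, ord.le m' mo) ∧ p = MvPolynomial.monomial mo 1}

/-- `I_Λ` has a Gröbner basis of degree `d` with respect to `⪯` iff `in_⪯(I_Λ)`
is generated by monomials of total degree at most `d`. -/
def HasGB (k : Type) [Field k] (ord : LinearOrder (Fin n →₀ ℕ)) (α : Fin n → M e)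
    (d : ℕ) : Prop :=
  ∃ G : Set (Fin n →₀ ℕ), (∀ mo ∈ G, (mo.sum fun _ c => c) ≤ d) ∧
    Ideal.span ((fun mo => (MvPolynomial.monomial mo 1 : MvPolynomial (Fin n) k)) '' G)
      = initialIdeal k ord α

end ASG
namespace ASG

variable {e n : ℕ}

/-- Faces of the `y`-graded piece of the normalized bar complex of `K` over
`K[Λ]`, in chain form: finite chains in `Λ` from `0` to `y`.  A basis element
`[x^(μ_1) | ⋯ | x^(μ_i)]` of multidegree `y = μ_1 + ⋯ + μ_i` (all `μ_j ≠ 0`)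
corresponds to the chain of partial sums `0 < μ_1 < μ_1 + μ_2 < ⋯ < y`. -/
def IsBFace (α : Fin n → M e) (y : M e) (S : Finset (M e)) : Prop :=
  (∀ μ ∈ S, μ ∈ sg α ∧ sgLE α μ y) ∧ (0 : M e) ∈ S ∧ y ∈ S ∧
    (S : Set (M e)).Pairwise (cmp2 α)

/-- Chains from `0` to `y` with `i + 1` elements, i.e. bar tableaux of
homological degree `i` and multidegree `y`. -/
def BFace (α : Fin n → M e) (y : M e) (i : ℕ) : Type :=
  { S : Finset (M e) // IsBFace α y S ∧ S.card = i + 1 }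

/-- The multidegree-`y` piece of the normalized bar complex of `K` over `K[Λ]`
in homological degree `i`. -/
abbrev TC (K : Type) [Field K] (α : Fin n → M e) (y : M e) (i : ℕ) : Type :=
  BFace α y i →₀ K

/-- Deleting an internal element of a bar chain. -/
def erasedBFace {α : Fin n → M e} {y : M e} {i : ℕ} (S : BFace α y i)
    (v : M e) (hv : v ∈ S.1) (h0 : v ≠ 0) (hy : v ≠ y) : BFace α y (i - 1) :=
  ⟨S.1.erase v,
    ⟨⟨fun μ hμ => S.2.1.1 μ (Finset.mem_of_mem_erase hμ),
      Finset.mem_erase.2 ⟨fun h => h0 h.symm, S.2.1.2.1⟩,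
      Finset.mem_erase.2 ⟨fun h => hy h.symm, S.2.1.2.2.1⟩,
      S.2.1.2.2.2.mono (Finset.coe_subset.mpr (Finset.erase_subset _ _))⟩,
    by
      have h2 : 1 < S.1.card :=
        Finset.one_lt_card.mpr ⟨0, S.2.1.2.1, v, hv, fun h => h0 h.symm⟩
      have hc := S.2.2
      rw [Finset.card_erase_of_mem hv]
      omega⟩⟩

/-- The differential of the (multidegree-`y` piece of the) normalized bar
complex: merging two adjacent bar entries corresponds to deleting an internal
element of the chain, with sign `(-1)^j` for the `j`-th element of the chain. -/
def tbd (K : Type) [Field K] (α : Fin n → M e) (y : M e) (i : ℕ) :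
    TC K α y i →ₗ[K] TC K α y (i - 1) :=
  Finsupp.linearCombination K fun S : BFace α y i =>
    ∑ v ∈ S.1.attach,
      if h : v.1 ≠ 0 ∧ v.1 ≠ y then
        ((-1 : K) ^ (S.1.filter fun w => sgLT α w v.1).card) •
          Finsupp.single (erasedBFace S v.1 v.2 h.1 h.2) 1
      else 0

/-- Vanishing of `Tor_i^{K[Λ]}(K, K)_y`, computed from the normalized bar
resolution of `K` over `K[Λ]` (which is `Λ`-graded): every cycle of the
multidegree-`y` piece of the bar complex in homological degree `i`
is a boundary. -/
def TorVanishes (K : Type) [Field K] (α : Fin n → M e) (y : M e) (i : ℕ) : Prop :=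
  ∀ c : TC K α y i, tbd K α y i c = 0 →
    ∃ b : TC K α y (i + 1), tbd K α y (i + 1) b = c

/-- `Tor_i^{K[Λ]}(K, K)_y`, computed from the normalized bar resolution of `K`
over `K[Λ]`: homology of the multidegree-`y` piece of the bar complex,
realized as the image of the cycles in the cokernel of the differential. -/
abbrev TorMod (K : Type) [Field K] (α : Fin n → M e) (y : M e) (i : ℕ) : Type :=
  ↥(Submodule.map (Submodule.mkQ (LinearMap.range (tbd K α y (i + 1))))
      (LinearMap.ker (tbd K α y i)))

end ASG
namespace ASG

variable {e n : ℕ}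

/-- `z_a z_b ∈ J`, where `J` is the set of quadratic monomials lying in the
initial ideal `in_⪯(I_Λ)`. -/
def Jrel (k : Type) [Field k] (ord : LinearOrder (Fin n →₀ ℕ)) (α : Fin n → M e)
    (a b : Fin n) : Prop :=
  (MvPolynomial.monomial (Finsupp.single a 1 + Finsupp.single b 1) (1 : k) :
    MvPolynomial (Fin n) k) ∈ initialIdeal k ord α

/-- One `J'`-commutation step on words of length `r` over the alphabet
`{z_1, …, z_n}`: interchanging two adjacent letters whose product is not in `J`. -/
def SwapStep (k : Type) [Field k] (ord : LinearOrder (Fin n →₀ ℕ)) (α : Fin n → M e)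
    (r : ℕ) (w w' : Fin r → Fin n) : Prop :=
  ∃ (t : ℕ) (h1 : t < r) (h2 : t + 1 < r),
    ¬ Jrel k ord α (w ⟨t, h1⟩) (w ⟨t + 1, h2⟩) ∧
    w' = Function.update (Function.update w ⟨t, h1⟩ (w ⟨t + 1, h2⟩)) ⟨t + 1, h2⟩ (w ⟨t, h1⟩)

/-- A word is `J'`-stuttering if it has two equal adjacent letters `z_a, z_a`
with `z_a^2 ∉ J`. -/
def Stutter (k : Type) [Field k] (ord : LinearOrder (Fin n →₀ ℕ)) (α : Fin n → M e)
    (r : ℕ) (w : Fin r → Fin n) : Prop :=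
  ∃ (t : ℕ) (h1 : t < r) (h2 : t + 1 < r),
    w ⟨t, h1⟩ = w ⟨t + 1, h2⟩ ∧ ¬ Jrel k ord α (w ⟨t, h1⟩) (w ⟨t, h1⟩)

/-- The `J'`-commuting equivalence class of `w` is `J'`-non-stuttering. -/
def NoStutterCl (k : Type) [Field k] (ord : LinearOrder (Fin n →₀ ℕ)) (α : Fin n → M e)
    (r : ℕ) (w : Fin r → Fin n) : Prop :=
  ∀ w', Relation.EqvGen (SwapStep k ord α r) w w' → ¬ Stutter k ord α r w'

/-- The set of `J'`-non-stuttering `J'`-commuting equivalence classes of words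
of length `r` and content `lam`. -/
def WordClasses (k : Type) [Field k] (ord : LinearOrder (Fin n →₀ ℕ)) (α : Fin n → M e)
    (r : ℕ) (lam : M e) : Type :=
  Quot fun a b : { w : Fin r → Fin n // (∑ t, α (w t)) = lam ∧ NoStutterCl k ord α r w } =>
    Relation.EqvGen (SwapStep k ord α r) a.1 b.1

/-- The number of `J'`-non-stuttering `J'`-commuting equivalence classes of
words of length `r` and content `lam`. -/
noncomputable def classCount (k : Type) [Field k] (ord : LinearOrder (Fin n →₀ ℕ))
    (α : Fin n → M e) (r : ℕ) (lam : M e) : ℕ :=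
  Nat.card (WordClasses k ord α r lam)

/-- The set of `J'`-non-stuttering `J'`-commuting equivalence classes of words
of length `r` (of arbitrary content). -/
def WordClassesAll (k : Type) [Field k] (ord : LinearOrder (Fin n →₀ ℕ)) (α : Fin n → M e)
    (r : ℕ) : Type :=
  Quot fun a b : { w : Fin r → Fin n // NoStutterCl k ord α r w } =>
    Relation.EqvGen (SwapStep k ord α r) a.1 b.1

end ASG

namespace ASGM
open Finsupp

section Morse
variable {K : Type} [Field K]

lemma supported_inj {Y Z : Type} [Finite Y] (d : (Y →₀ K) →ₗ[K] (Z →₀ K)) (A : Set Y) (pr : Y → Z → Prop) (hpr : ∀ a ∈ A, ∃ x, pr a x)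
    (R : Y → Y → Prop) (htr : ∀ a b c, R a b → R b c → R a c) (hir : ∀ a, ¬ R a a)
    (unit : ∀ a x, pr a x → d (single a 1) x ≠ 0)
    (acyc : ∀ a x, pr a x → ∀ a' ∈ A, a' ≠ a → d (single a' 1) x ≠ 0 → R a a')
    (z : Y →₀ K) (hz : z ∈ Finsupp.supported K K A) (h : d z = 0) : z = 0 := by
  by_contra hne
  have hwf : WellFounded (fun a b => R b a) := by
    have : IsTrans Y (fun a b => R b a) := ⟨fun a b c h1 h2 => htr _ _ _ h2 h1⟩
    have : Std.Irrefl (fun a b : Y => R b a) := ⟨fun a h => hir a h⟩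
    exact Finite.wellFounded_of_trans_of_irrefl _
  obtain ⟨a0, ha0⟩ : ∃ a, a ∈ z.support := by
    by_contra hcon
    push Not at hcon
    exact hne (Finsupp.support_eq_empty.1 (Finset.eq_empty_of_forall_notMem hcon))
  obtain ⟨a, ha, hmax⟩ := hwf.has_min {a | a ∈ z.support} ⟨a0, ha0⟩
  have hzA : ∀ b ∈ z.support, b ∈ A := fun b hb => (Finsupp.mem_supported K z).1 hz hb
  have e1 : d z = ∑ b ∈ z.support, z b • d (single b 1) := by
    conv_lhs => rw [← Finsupp.sum_single z]
    rw [Finsupp.sum, map_sum]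
    refine Finset.sum_congr rfl fun b _ => ?_
    rw [← map_smul, Finsupp.smul_single, smul_eq_mul, mul_one]
  obtain ⟨x, hx⟩ := hpr a (hzA a ha)
  have e2 : (d z) x = z a * d (single a 1) x := by
    rw [e1, Finsupp.finsetSum_apply, Finset.sum_eq_single a]
    · simp
    · intro b hb hba
      by_contra hcon
      have : d (single b 1) x ≠ 0 := by
        intro h0; apply hcon; simp [h0]
      exact hmax b hb (acyc a x hx b (hzA b hb) hba this)
    · intro h'; exact absurd ha h'
  rw [h] at e2
  have := mul_ne_zero (Finsupp.mem_support_iff.1 ha) (unit a x hx)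
  exact this e2.symm

/-- rewriting a bottom cell -/
lemma bottom_rewrite {Y Z : Type} [Finite Y] (d : (Y →₀ K) →ₗ[K] (Z →₀ K)) (A : Set Y) (B : Set Z)
    (pr : Y → Z → Prop) (hμ : ∀ b ∈ B, ∃ a ∈ A, pr a b)
    (hfun : ∀ a x y, pr a x → pr a y → x = y)
    (R : Y → Y → Prop) (htr : ∀ a b c, R a b → R b c → R a c) (hir : ∀ a, ¬ R a a)
    (unit : ∀ a x, pr a x → d (single a 1) x ≠ 0)
    (acyc : ∀ a x, pr a x → ∀ a' ∈ A, a' ≠ a → d (single a' 1) x ≠ 0 → R a a')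
    (G : Z → Prop) (hG : ∀ a x, pr a x → G x → ∀ y, d (single a 1) y ≠ 0 → G y)
    (U : Submodule K (Z →₀ K)) (hU1 : ∀ a ∈ A, d (single a 1) ∈ U)
    (hU2 : ∀ y, G y → y ∉ B → single y 1 ∈ U) (x : Z) (hx : G x) : single x 1 ∈ U := by
  have hwf : WellFounded R := by
    have : IsTrans Y R := ⟨htr⟩
    have : Std.Irrefl R := ⟨hir⟩
    exact Finite.wellFounded_of_trans_of_irrefl _
  have key : ∀ a, a ∈ A → ∀ x, pr a x → G x → single x (1 : K) ∈ U := by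
    intro a
    induction a using hwf.induction with
    | _ a ih =>
    intro ha x hax hGa
    set f := d (single a 1) with hf
    have hfU : f ∈ U := hU1 a ha
    have hu : f x ≠ 0 := unit a x hax
    have hother : Finsupp.erase x f ∈ U := by
      rw [← Finsupp.sum_single (Finsupp.erase x f)]
      refine Submodule.sum_mem _ fun y hy => ?_
      have hyne : y ≠ x := by
        rintro rfl
        simp at hy
      have hfy : f y ≠ 0 := by
        have := Finsupp.mem_support_iff.1 hy
        rwa [Finsupp.erase_ne hyne] at this
      have hGy : G y := hG a x hax hGa y hfy
      have hs : single y (1 : K) ∈ U := by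
        by_cases hyB : y ∈ B
        · obtain ⟨a', ha', hpa⟩ := hμ y hyB
          by_cases hne : a = a'
          · subst hne
            exact absurd (hfun a y x hpa hax) hyne
          exact ih a' (acyc a' y hpa a ha hne hfy) ha' y hpa hGy
        · exact hU2 y hGy hyB
      have : single y ((Finsupp.erase x f) y) = ((Finsupp.erase x f) y) • single y (1 : K) := by
        rw [Finsupp.smul_single, smul_eq_mul, mul_one]
      rw [this]
      exact U.smul_mem _ hs
    have hdec : single x (f x) ∈ U := by
      have := U.sub_mem hfU hother
      rwa [← Finsupp.single_add_erase x f, Finsupp.single_add_erase, sub_eq_iff_eq_add.2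
        (Finsupp.single_add_erase x f).symm] at this
    have := U.smul_mem (f x)⁻¹ hdec
    rwa [Finsupp.smul_single, smul_eq_mul, inv_mul_cancel₀ hu] at this
  by_cases hxB : x ∈ B
  · obtain ⟨a, ha, hpa⟩ := hμ x hxB
    exact key a ha x hpa hx
  · exact hU2 x hx hxB

theorem morse_rank (X : ℕ → Type) [∀ i, Finite (X i)]
    (d : ∀ i, (X (i+1) →₀ K) →ₗ[K] (X i →₀ K))
    (dd : ∀ i x, d i (d (i+1) x) = 0)
    (A B Cr : ∀ i, Set (X i))
    (hcov : ∀ i x, x ∈ A i ∨ x ∈ B i ∨ x ∈ Cr i)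
    (hA0 : ∀ x, x ∉ A 0)
    (pr : ∀ i, X (i+1) → X i → Prop) (hpr : ∀ i, ∀ a ∈ A (i+1), ∃ x, pr i a x)
    (hμ : ∀ i, ∀ b ∈ B i, ∃ a ∈ A (i+1), pr i a b)
    (hfun : ∀ i a x y, pr i a x → pr i a y → x = y)
    (R : ∀ i, X i → X i → Prop)
    (htr : ∀ i a b c, R i a b → R i b c → R i a c) (hir : ∀ i a, ¬ R i a a)
    (unit : ∀ i a x, pr i a x → d i (single a 1) x ≠ 0)
    (acyc : ∀ i a x, pr i a x → ∀ a' ∈ A (i+1), a' ≠ a →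
      d i (single a' 1) x ≠ 0 → R (i+1) a a')
    (len : ∀ i, X i → ℕ)
    (hlen : ∀ i x y, d i (single x 1) y ≠ 0 → len (i+1) x ≤ len i y)
    (lenμ : ∀ i a x, pr i a x → len i x ≤ len (i+1) a)
    (lenCr : ∀ i, ∀ x ∈ Cr i, len i x = i) (i : ℕ) :
    Module.finrank K (LinearMap.range (d i)) = Nat.card (A (i+1)) := by
  have inj : ∀ j (z : X j →₀ K), z ∈ Finsupp.supported K K (A j) →
      (∀ j', ∀ h : j = j' + 1, d j' (h ▸ z) = 0) → z = 0 := by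
    intro j z hz h
    cases j with
    | zero =>
      by_contra hne
      apply hne
      ext x
      by_contra hx
      exact hA0 x ((Finsupp.mem_supported K z).1 hz (Finsupp.mem_support_iff.2 hx))
    | succ j =>
      exact supported_inj (d j) (A (j+1)) (pr j) (hpr j) (R (j+1)) (htr _) (hir _) (unit j) (acyc j) z hz
        (h j rfl)
  set V : Submodule K (X (i+1) →₀ K) := Finsupp.supported K K (A (i+1)) with hV
  have L2 : ∀ z : X i →₀ K, (∀ x ∈ z.support, i < len i x) →
      (∀ j', ∀ h : i = j' + 1, d j' (h ▸ z) = 0) → z ∈ Submodule.map (d i) V := by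
    intro z hz hcyc
    have hzU : z ∈ Submodule.map (d i) V ⊔ Finsupp.supported K K (A i) := by
      rw [← Finsupp.sum_single z]
      refine Submodule.sum_mem _ fun x hx => ?_
      have : single x (z x) = z x • single x (1 : K) := by
        rw [Finsupp.smul_single, smul_eq_mul, mul_one]
      rw [this]
      refine Submodule.smul_mem _ _ ?_
      refine bottom_rewrite (d i) (A (i+1)) (B i) (pr i) (hμ i) (hfun i)
        (R (i+1)) (htr _) (hir _) (unit i) (acyc i) (fun y => i < len i y) ?_ _ ?_ ?_ x (hz x hx)
      · intro a x' ha h1 y hy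
        exact lt_of_lt_of_le h1 ((lenμ i a x' ha).trans (hlen i a y hy))
      · intro a ha
        exact Submodule.mem_sup_left ⟨_, Finsupp.single_mem_supported K 1 ha, rfl⟩
      · intro y hy hyB
        rcases hcov i y with h | h | h
        · exact Submodule.mem_sup_right (Finsupp.single_mem_supported K 1 h)
        · exact absurd h hyB
        · have := lenCr i y h
          omega
    obtain ⟨u, hu, z', hz', rfl⟩ := Submodule.mem_sup.1 hzU
    have : z' = 0 := by
      refine inj i z' hz' ?_
      intro j' h
      subst h
      have h1 := hcyc j' rfl
      obtain ⟨v, -, rfl⟩ := hu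
      simpa [map_add, dd] using h1
    rw [this, add_zero]
    exact hu
  have L3 : LinearMap.range (d i) = Submodule.map (d i) V := by
    apply le_antisymm
    · rintro _ ⟨w, rfl⟩
      have : ∀ x, single x (1 : K) ∈ Submodule.comap (d i) (Submodule.map (d i) V) := by
        intro x
        refine bottom_rewrite (d (i+1)) (A (i+2)) (B (i+1)) (pr (i+1))
          (hμ (i+1)) (hfun (i+1))
          (R (i+2)) (htr _) (hir _) (unit (i+1)) (acyc (i+1)) (fun y => True) (fun _ _ _ _ _ _ => trivial)
          _ ?_ ?_ x trivial
        · intro a ha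
          rw [Submodule.mem_comap, dd]
          exact zero_mem _
        · intro y _ hyB
          rcases hcov (i+1) y with h | h | h
          · exact ⟨_, Finsupp.single_mem_supported K 1 h, rfl⟩
          · exact absurd h hyB
          · rw [Submodule.mem_comap]
            apply L2
            · intro x hx
              have h1 := hlen i y x (Finsupp.mem_support_iff.1 hx)
              have h2 := lenCr (i+1) y h
              omega
            · intro j' h'
              subst h'
              exact dd _ _
      have hw : w ∈ Submodule.comap (d i) (Submodule.map (d i) V) := by
        rw [← Finsupp.sum_single w]
        refine Submodule.sum_mem _ fun x hx => ?_
        have h' : single x (w x) = w x • single x (1 : K) := by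
          rw [Finsupp.smul_single, smul_eq_mul, mul_one]
        rw [h']
        exact Submodule.smul_mem _ _ (this x)
      exact hw
    · exact LinearMap.map_le_range
  rw [L3]
  have hinj : Function.Injective ((d i).domRestrict V) := by
    refine (injective_iff_map_eq_zero _).2 ?_
    rintro ⟨z, hz⟩ h
    have := supported_inj (d i) (A (i+1)) (pr i) (hpr i) (R (i+1)) (htr _) (hir _) (unit i) (acyc i) z hz h
    exact Subtype.ext this
  have h1 : Submodule.map (d i) V = LinearMap.range ((d i).domRestrict V) := by
    rw [LinearMap.range_domRestrict]
  rw [h1, LinearMap.finrank_range_of_inj hinj, (Finsupp.supportedEquivFinsupp (A (i+1))).finrank_eq]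
  have : Fintype (A (i+1)) := Fintype.ofFinite _
  rw [Module.finrank_finsupp_self, Nat.card_eq_fintype_card]

lemma finrank_homology {V W Z : Type} [AddCommGroup V] [AddCommGroup W] [AddCommGroup Z]
    [Module K V] [Module K W] [Module K Z] [FiniteDimensional K V] [FiniteDimensional K W]
    (f : V →ₗ[K] W) (g : W →ₗ[K] Z) (h : ∀ x, g (f x) = 0) :
    Module.finrank K (Submodule.map (Submodule.mkQ (LinearMap.range f)) (LinearMap.ker g))
      + Module.finrank K (LinearMap.range f) + Module.finrank K (LinearMap.range g)
      = Module.finrank K W := by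
  have h1 := LinearMap.finrank_range_add_finrank_ker g
  set q := (Submodule.mkQ (LinearMap.range f)).domRestrict (LinearMap.ker g) with hq
  have h2 := LinearMap.finrank_range_add_finrank_ker q
  have h3 : LinearMap.range q = Submodule.map (Submodule.mkQ (LinearMap.range f)) (LinearMap.ker g) := by
    rw [hq, LinearMap.range_domRestrict]
  have hle : LinearMap.range f ≤ LinearMap.ker g := by
    rintro _ ⟨x, rfl⟩; exact h x
  have h4 : Module.finrank K (LinearMap.ker q) = Module.finrank K (LinearMap.range f) := by
    have : LinearMap.ker q = Submodule.comap (LinearMap.ker g).subtype (LinearMap.range f) := by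
      ext x
      simp [hq, LinearMap.domRestrict_apply]
    rw [this]
    exact (Submodule.comapSubtypeEquivOfLe hle).finrank_eq
  rw [h3, h4] at h2
  omega

end Morse
end ASGM

namespace ASGM
open Finsupp

section Comb
variable {n : ℕ}

/-- abbreviation for exponent vectors -/
abbrev Mo (n : ℕ) : Type := Fin n →₀ ℕ

/-- monomials all of whose pairs of letters commute -/
def Cq (J : Fin n → Fin n → Prop) (m : Mo n) : Prop :=
  ∀ a b, single a 1 + single b 1 ≤ m → ¬ J a b

/-- update of the set of letters allowed to continue a critical word -/
def stp (J : Fin n → Fin n → Prop) (P : Fin n → Prop) (y z : Fin n) : Prop :=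
  J y z ∨ (P z ∧ y < z)

/-- critical words -/
def crit (J : Fin n → Fin n → Prop) : (Fin n → Prop) → List (Fin n) → Prop
  | _, [] => True
  | P, y :: v => P y ∧ crit J (stp J P y) v

/-- The matching: `Q` is the top cell, `Q'` its partner, `w` the critical prefix. -/
inductive Top (J : Fin n → Fin n → Prop) :
    (Fin n → Prop) → List (Fin n) → List (Mo n) → List (Mo n) → Prop
  | here (P : Fin n → Prop) (y : Fin n) (m : Mo n) (L : List (Mo n)) (hy : P y) (hm : m ≠ 0)
      (h : ∀ z, m z ≠ 0 → ¬ stp J P y z) :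
      Top J P [y] (single y 1 :: m :: L) ((single y 1 + m) :: L)
  | there (P : Fin n → Prop) (y : Fin n) (w : List (Fin n)) (Q Q' : List (Mo n)) (hy : P y)
      (h : Top J (stp J P y) w Q Q') :
      Top J P (y :: w) (single y 1 :: Q) (List.cons (single y 1) Q' : List (Mo n))

/-- Clean merges of adjacent blocks. -/
inductive CMerge : List (Mo n) → List (Mo n) → Prop
  | head (a b : Mo n) (L : List (Mo n)) : CMerge (a :: b :: L) ((a + b) :: L)
  | cons (a : Mo n) (L L' : List (Mo n)) (h : CMerge L L') : CMerge (a :: L) (a :: L')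

lemma single_ne_add {y y2 : Fin n} {m : Mo n} (hm : m ≠ 0) : single y 1 ≠ single y2 1 + m := by
  intro h
  have := congrArg Finsupp.degree h
  simp only [map_add, Finsupp.degree_single] at this
  have h2 : Finsupp.degree m = 0 := by omega
  exact hm ((Finsupp.degree_eq_zero_iff m).1 h2)

lemma add_eq_single {y : Fin n} {a b : Mo n} (ha : a ≠ 0) (hb : b ≠ 0) : a + b ≠ single y 1 := by
  intro h
  have := congrArg Finsupp.degree h
  simp only [map_add, Finsupp.degree_single] at this
  have h1 : Finsupp.degree a ≠ 0 := fun h => ha ((Finsupp.degree_eq_zero_iff a).1 h)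
  have h2 : Finsupp.degree b ≠ 0 := fun h => hb ((Finsupp.degree_eq_zero_iff b).1 h)
  omega

lemma Top.head {J : Fin n → Fin n → Prop} {P w Q Q'} (h : Top J P w Q Q') :
    ∃ y L, P y ∧ Q = single y 1 :: L := by
  cases h with
  | here _ y m L hy hm h => exact ⟨_, _, hy, rfl⟩
  | there _ y w Q Q' hy h => exact ⟨_, _, hy, rfl⟩

lemma Top.head' {J : Fin n → Fin n → Prop} {P w Q Q'} (h : Top J P w Q Q') :
    ∃ y m L, P y ∧ Q' = m :: L ∧ m y ≠ 0 := by
  cases h with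
  | here _ y m L hy hm h => exact ⟨y, _, _, hy, rfl, by simp⟩
  | there _ y w Q Q' hy h => exact ⟨y, _, _, hy, rfl, by simp⟩

lemma Top.ne_nil {J : Fin n → Fin n → Prop} {P w Q Q'} (h : Top J P w Q Q') : w ≠ [] := by
  cases h <;> simp

lemma Top.cmerge {J : Fin n → Fin n → Prop} {P w Q Q'} (h : Top J P w Q Q') : CMerge Q Q' := by
  induction h with
  | here P y m L hy hm h => exact CMerge.head _ _ _
  | there P y w Q Q' hy h ih => exact CMerge.cons _ _ _ ih

lemma CMerge.sum {Q Q' : List (Mo n)} (h : CMerge Q Q') : Q.sum = Q'.sum := by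
  induction h with
  | head a b L => simp [add_assoc]
  | cons a L L' h ih => simp [ih]

lemma CMerge.length {Q Q' : List (Mo n)} (h : CMerge Q Q') : Q.length = Q'.length + 1 := by
  induction h with
  | head a b L => simp
  | cons a L L' h ih => simp [ih]

lemma single_inj' {y y' : Fin n} (h : (single y 1 : Mo n) = single y' 1) : y = y' := by
  exact (Finsupp.single_left_inj one_ne_zero).1 h

lemma Top.func {J : Fin n → Fin n → Prop} {P w Q Q'} (h : Top J P w Q Q') :
    ∀ {w2 Q2}, Top J P w2 Q Q2 → Q' = Q2 ∧ w = w2 := by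
  induction h with
  | here P y m L hy hm h =>
    intro w2 Q2 h2
    generalize hQ : single y 1 :: m :: L = Q at h2
    cases h2 with
    | here _ y2 m2 L2 hy2 hm2 h2 =>
      simp only [List.cons.injEq] at hQ
      obtain ⟨h1, rfl, rfl⟩ := hQ
      obtain rfl := single_inj' h1
      exact ⟨rfl, rfl⟩
    | there _ y2 w2 Q2 Q2' hy2 h2 =>
      simp only [List.cons.injEq] at hQ
      obtain ⟨h1, rfl⟩ := hQ
      obtain rfl := single_inj' h1
      obtain ⟨y', L', h3, h4⟩ := h2.head
      simp only [List.cons.injEq] at h4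
      exact absurd h3 (h y' (by simp [h4.1]))
  | there P y w Q Q' hy h ih =>
    intro w2 Q2 h2
    generalize hQ : single y 1 :: Q = Q0 at h2
    cases h2 with
    | here _ y2 m2 L2 hy2 hm2 h2 =>
      simp only [List.cons.injEq] at hQ
      obtain ⟨h1, rfl⟩ := hQ
      obtain rfl := single_inj' h1
      obtain ⟨y', L', h3, h4⟩ := h.head
      simp only [List.cons.injEq] at h4
      exact absurd h3 (h2 y' (by simp [h4.1]))
    | there _ y2 w2 Q2 Q2' hy2 h2 =>
      simp only [List.cons.injEq] at hQ
      obtain ⟨h1, rfl⟩ := hQ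
      obtain rfl := single_inj' h1
      obtain ⟨rfl, rfl⟩ := ih h2
      exact ⟨rfl, rfl⟩

lemma split_unique {J : Fin n → Fin n → Prop} {P : Fin n → Prop} {y y2 : Fin n} {m m2 : Mo n}
    (hy2 : P y2) (h : ∀ z, m z ≠ 0 → ¬ stp J P y z)
    (he : single y 1 + m = single y2 1 + m2) : y = y2 ∨ (y2 < y ∧ m2 y ≠ 0) := by
  by_cases hne : y = y2
  · exact Or.inl hne
  right
  have h1 : m y2 ≠ 0 := by
    have := DFunLike.congr_fun he y2
    simp [Finsupp.single_apply, hne] at this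
    omega
  have h2 : m2 y ≠ 0 := by
    have := DFunLike.congr_fun he y
    simp [Finsupp.single_apply, Ne.symm hne] at this
    omega
  refine ⟨?_, h2⟩
  have := h y2 h1
  by_contra hlt
  exact this (Or.inr ⟨hy2, lt_of_le_of_ne (not_lt.1 hlt) hne⟩)

lemma Top.inj {J : Fin n → Fin n → Prop} {P w Q Q'} (h : Top J P w Q Q') :
    ∀ {w2 Q2}, Top J P w2 Q2 Q' → Q = Q2 := by
  induction h with
  | here P y m L hy hm h =>
    intro w2 Q2 h2
    generalize hQ : (single y 1 + m) :: L = Q at h2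
    cases h2 with
    | here _ y2 m2 L2 hy2 hm2 h2 =>
      simp only [List.cons.injEq] at hQ
      obtain ⟨h1, rfl⟩ := hQ
      rcases split_unique hy2 h h1 with rfl | h3
      · rw [add_left_cancel h1]
      · rcases split_unique hy h2 h1.symm with rfl | h4
        · exact absurd h3.1 (lt_irrefl _)
        · exact absurd h3.1 h4.1.asymm
    | there _ y2 w2 Q2 Q2' hy2 h2 =>
      simp only [List.cons.injEq] at hQ
      exact absurd hQ.1.symm (single_ne_add hm)
  | there P y w Q Q' hy h ih =>
    intro w2 Q2 h2
    generalize hQ : single y 1 :: Q' = Q0 at h2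
    cases h2 with
    | here _ y2 m2 L2 hy2 hm2 h2 =>
      simp only [List.cons.injEq] at hQ
      exact absurd hQ.1 (single_ne_add hm2)
    | there _ y2 w2 Q2 Q2' hy2 h2 =>
      simp only [List.cons.injEq] at hQ
      obtain ⟨h1, rfl⟩ := hQ
      obtain rfl := single_inj' h1
      rw [ih h2]

lemma Top.not_bot {J : Fin n → Fin n → Prop} {P w Q Q'} (h : Top J P w Q Q') :
    ∀ {w2 Q2}, ¬ Top J P w2 Q2 Q := by
  induction h with
  | here P y m L hy hm h =>
    intro w2 Q2 h2
    generalize hQ : single y 1 :: m :: L = Q at h2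
    cases h2 with
    | here _ y2 m2 L2 hy2 hm2 h2 =>
      simp only [List.cons.injEq] at hQ
      exact absurd hQ.1 (single_ne_add hm2)
    | there _ y2 w2 Q2 Q2' hy2 h2 =>
      simp only [List.cons.injEq] at hQ
      obtain ⟨h1, rfl⟩ := hQ
      obtain rfl := single_inj' h1
      obtain ⟨y', m', L', h3, h4, h5⟩ := h2.head'
      simp only [List.cons.injEq] at h4
      exact absurd h3 (h y' (by rw [h4.1]; exact h5))
  | there P y w Q Q' hy h ih =>
    intro w2 Q2 h2
    generalize hQ : single y 1 :: Q = Q0 at h2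
    cases h2 with
    | here _ y2 m2 L2 hy2 hm2 h2 =>
      simp only [List.cons.injEq] at hQ
      exact absurd hQ.1 (single_ne_add hm2)
    | there _ y2 w2 Q2 Q2' hy2 h2 =>
      simp only [List.cons.injEq] at hQ
      obtain ⟨h1, rfl⟩ := hQ
      obtain rfl := single_inj' h1
      exact ih h2

/-- the cell of a word -/
def wcell (v : List (Fin n)) : List (Mo n) := v.map fun y => single y 1

lemma Top.not_crit {J : Fin n → Fin n → Prop} {P w Q Q'} (h : Top J P w Q Q') :
    ∀ {v}, crit J P v → Q ≠ wcell v := by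
  induction h with
  | here P y m L hy hm h =>
    intro v hv hQ
    match v, hv with
    | [], _ => simp [wcell] at hQ
    | [_], _ => simp [wcell] at hQ
    | y1 :: y2 :: v, hv =>
      simp only [wcell, List.map_cons, List.cons.injEq] at hQ
      obtain ⟨h1, h2, -⟩ := hQ
      obtain rfl := single_inj' h1
      exact h y2 (by simp [h2]) hv.2.1
  | there P y w Q Q' hy h ih =>
    intro v hv hQ
    match v, hv with
    | [], _ => simp [wcell] at hQ
    | y1 :: v, hv =>
      simp only [wcell, List.map_cons, List.cons.injEq] at hQ
      obtain ⟨h1, h2⟩ := hQ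
      obtain rfl := single_inj' h1
      exact ih hv.2 h2

lemma Top.not_crit' {J : Fin n → Fin n → Prop} {P w Q Q'} (h : Top J P w Q Q') :
    ∀ {v}, Q' ≠ wcell v := by
  induction h with
  | here P y m L hy hm h =>
    intro v hQ
    match v with
    | [] => simp [wcell] at hQ
    | y1 :: v =>
      simp only [wcell, List.map_cons, List.cons.injEq] at hQ
      exact single_ne_add hm hQ.1.symm
  | there P y w Q Q' hy h ih =>
    intro v hQ
    match v with
    | [] => simp [wcell] at hQ
    | y1 :: v =>
      simp only [wcell, List.map_cons, List.cons.injEq] at hQ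
      exact ih hQ.2

lemma trich (J : Fin n → Fin n → Prop) (Q : List (Mo n)) :
    ∀ (P : Fin n → Prop), (∀ m ∈ Q, m ≠ 0 ∧ Cq J m) →
    (∀ m L, Q = m :: L → ∃ z, m z ≠ 0 ∧ P z) →
    (∃ w Q', Top J P w Q Q') ∨ (∃ w Q0, Top J P w Q0 Q) ∨ ∃ v, crit J P v ∧ Q = wcell v := by
  induction Q with
  | nil => intro P _ _; exact Or.inr (Or.inr ⟨[], trivial, rfl⟩)
  | cons m R ih =>
    intro P hQ hP
    obtain ⟨y, ⟨hmy, hPy⟩, hmax⟩ : ∃ y, (m y ≠ 0 ∧ P y) ∧ ∀ z, m z ≠ 0 ∧ P z → z ≤ y := by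
      obtain ⟨z, hz⟩ := hP m R rfl
      have hne : (Finset.univ.filter fun z => m z ≠ 0 ∧ P z).Nonempty := ⟨z, by simpa using hz⟩
      obtain ⟨y, hy, hmax⟩ := Finset.exists_max_image _ id hne
      refine ⟨y, by simpa using hy, fun z hz => hmax z (by simpa using hz)⟩
    have hle : single y 1 ≤ m := by
      rw [Finsupp.single_le_iff]; omega
    obtain ⟨m', rfl⟩ := exists_add_of_le hle
    by_cases hm' : m' = 0
    · subst hm'
      rw [add_zero] at *
      match R, ih, hQ, hP with
      | [], _, _, _ => exact Or.inr (Or.inr ⟨[y], ⟨hPy, trivial⟩, rfl⟩)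
      | m2 :: R, ih, hQ, hP =>
        by_cases hs : ∃ z, m2 z ≠ 0 ∧ stp J P y z
        · rcases ih (stp J P y) (fun m hm => hQ m (List.mem_cons_of_mem _ hm))
            (by rintro m L h; simp only [List.cons.injEq] at h; rw [← h.1]; exact hs) with
            ⟨w, Q', h⟩ | ⟨w, Q0, h⟩ | ⟨v, hv, h⟩
          · exact Or.inl ⟨_, _, Top.there _ _ _ _ _ hPy h⟩
          · exact Or.inr (Or.inl ⟨_, _, Top.there _ _ _ _ _ hPy h⟩)
          · exact Or.inr (Or.inr ⟨y :: v, ⟨hPy, hv⟩, by rw [h]; rfl⟩)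
        · push Not at hs
          exact Or.inl ⟨_, _, Top.here P y m2 R hPy (hQ m2 (by simp)).1 hs⟩
    · refine Or.inr (Or.inl ⟨_, _, Top.here P y m' R hPy hm' ?_⟩)
      rintro z hz (hJ | ⟨hPz, hlt⟩)
      · refine (hQ _ List.mem_cons_self).2 y z ?_ hJ
        gcongr
        rw [Finsupp.single_le_iff]; omega
      · exact absurd (hmax z ⟨by simp [hz], hPz⟩) (not_le.2 hlt)

lemma Cq.mono {J : Fin n → Fin n → Prop} {m m' : Mo n} (h : Cq J m') (hle : m ≤ m') : Cq J m :=
  fun a b hab => h a b (hab.trans hle)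

lemma Cq.single_add {J : Fin n → Fin n → Prop} (hs : ∀ a b, J a b → J b a) {P : Fin n → Prop}
    {y : Fin n} {m : Mo n} (hm : Cq J m) (h : ∀ z, m z ≠ 0 → ¬ stp J P y z) :
    Cq J (single y 1 + m) := by
  intro a b hab hJ
  have key : ∀ a b, single a 1 + single b 1 ≤ single y 1 + m → a = y → J a b → False := by
    rintro a b hab rfl hJ
    have := le_of_add_le_add_left hab
    rw [Finsupp.single_le_iff] at this
    exact h b (by omega) (Or.inl hJ)
  by_cases ha : a = y
  · exact key a b hab ha hJ
  by_cases hb : b = y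
  · exact key b a (by rwa [add_comm]) hb (hs _ _ hJ)
  refine hm a b ?_ hJ
  intro z
  have := hab z
  by_cases hz : y = z
  · subst hz
    simp [Finsupp.single_apply, ha, hb]
  · simpa [Finsupp.single_apply, hz] using this

/-- well-formed cells -/
def WF (J : Fin n → Fin n → Prop) (Q : List (Mo n)) : Prop := ∀ m ∈ Q, m ≠ 0 ∧ Cq J m

lemma Top.wf_bot {J : Fin n → Fin n → Prop} (hs : ∀ a b, J a b → J b a) {P w Q Q'}
    (h : Top J P w Q Q') (hQ : WF J Q) : WF J Q' := by
  induction h with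
  | here P y m L hy hm h =>
    intro x hx
    rcases List.mem_cons.1 hx with rfl | hx
    · refine ⟨?_, Cq.single_add hs (hQ m (by simp)).2 h⟩
      intro h0
      have := DFunLike.congr_fun h0 y
      simp at this
    · exact hQ x (by simp [hx])
  | there P y w Q Q' hy h ih =>
    intro x hx
    rcases List.mem_cons.1 hx with rfl | hx
    · exact hQ _ (by simp)
    · exact ih (fun m hm => hQ m (by simp [hm])) x hx

lemma Top.wf_top {J : Fin n → Fin n → Prop} {P w Q Q'}
    (h : Top J P w Q Q') (hQ : WF J Q') : WF J Q := by
  induction h with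
  | here P y m L hy hm h =>
    have h0 := hQ _ List.mem_cons_self
    intro x hx
    rcases List.mem_cons.1 hx with rfl | hx
    · exact ⟨by simp, h0.2.mono le_self_add⟩
    rcases List.mem_cons.1 hx with rfl | hx
    · exact ⟨hm, h0.2.mono le_add_self⟩
    · exact hQ x (by simp [hx])
  | there P y w Q Q' hy h ih =>
    intro x hx
    rcases List.mem_cons.1 hx with rfl | hx
    · exact hQ _ (by simp)
    · exact ih (fun m hm => hQ m (by simp [hm])) x hx

lemma acyclic {J : Fin n → Fin n → Prop} {P w Q Q'} (h : Top J P w Q Q') :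
    ∀ {w2 Q2 Q2'}, Top J P w2 Q2 Q2' → (∀ m ∈ Q2, m ≠ 0) → CMerge Q2 Q' → Q2 ≠ Q → w2 < w := by
  induction h with
  | here P y m L hy hm h =>
    intro w2 Q2 Q2' h2 hnz hM hne
    generalize hQ : (single y 1 + m) :: L = Q' at hM
    cases hM with
    | head n1 n2 L2 =>
      simp only [List.cons.injEq] at hQ
      obtain ⟨h1, rfl⟩ := hQ
      obtain ⟨y1, L', hy1, h3⟩ := h2.head
      simp only [List.cons.injEq] at h3
      obtain ⟨rfl, rfl⟩ := h3
      rcases split_unique hy1 h h1 with rfl | h4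
      · exact absurd (by rw [add_left_cancel h1]) hne
      · generalize hQ : single y1 1 :: n2 :: L = Q at h2
        cases h2 with
        | here _ y3 m3 L3 hy3 hm3 h3 =>
          simp only [List.cons.injEq] at hQ
          obtain ⟨h5, rfl, rfl⟩ := hQ
          obtain rfl := single_inj' h5
          exact absurd (Or.inr ⟨hy, h4.1⟩) (h3 y h4.2)
        | there _ y3 w3 Q3 Q3' hy3 h3 =>
          simp only [List.cons.injEq] at hQ
          obtain ⟨h5, rfl⟩ := hQ
          obtain rfl := single_inj' h5
          exact List.Lex.rel h4.1
    | cons a L1 L2 hM =>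
      simp only [List.cons.injEq] at hQ
      obtain ⟨rfl, rfl⟩ := hQ
      obtain ⟨y1, L', hy1, h3⟩ := h2.head
      simp only [List.cons.injEq] at h3
      exact absurd h3.1.symm (single_ne_add hm)
  | there P y w Q Q' hy h ih =>
    intro w2 Q2 Q2' h2 hnz hM hne
    generalize hQ : single y 1 :: Q' = Q0 at hM
    cases hM with
    | head n1 n2 L2 =>
      simp only [List.cons.injEq] at hQ
      exact absurd hQ.1.symm (add_eq_single (hnz _ (by simp)) (hnz _ (by simp)))
    | cons a L1 L2 hM =>
      simp only [List.cons.injEq] at hQ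
      obtain ⟨rfl, rfl⟩ := hQ
      generalize hQ : single y 1 :: L1 = Q0 at h2
      cases h2 with
      | here _ y3 m3 L3 hy3 hm3 h3 =>
        simp only [List.cons.injEq] at hQ
        obtain ⟨h5, rfl⟩ := hQ
        obtain rfl := single_inj' h5
        obtain ⟨c, w', rfl⟩ := List.exists_cons_of_ne_nil h.ne_nil
        exact List.Lex.cons List.Lex.nil
      | there _ y3 w3 Q3 Q3' hy3 h3 =>
        simp only [List.cons.injEq] at hQ
        obtain ⟨h5, rfl⟩ := hQ
        obtain rfl := single_inj' h5
        exact List.Lex.cons (ih h3 (fun m hm => hnz m (by simp [hm])) hM (fun h => hne (by rw [h])))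

end Comb
end ASGM

namespace ASGM
open Finsupp

section Words
variable {n : ℕ}

/-- `a` can be moved to the front of `w`, leaving `r`. -/
inductive Front (J : Fin n → Fin n → Prop) (a : Fin n) : List (Fin n) → List (Fin n) → Prop
  | head (r : List (Fin n)) : Front J a (a :: r) r
  | cons (b : Fin n) (w r : List (Fin n)) (hne : a ≠ b) (hJ : ¬ J b a) (h : Front J a w r) :
      Front J a (b :: w) (b :: r)

/-- trace equivalence -/
inductive Tr (J : Fin n → Fin n → Prop) : List (Fin n) → List (Fin n) → Prop
  | refl (w : List (Fin n)) : Tr J w w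
  | swap (a b : Fin n) (w : List (Fin n)) (hJ : ¬ J a b) : Tr J (a :: b :: w) (b :: a :: w)
  | cons (a : Fin n) (w w' : List (Fin n)) (h : Tr J w w') : Tr J (a :: w) (a :: w')
  | trans (u v w : List (Fin n)) (h : Tr J u v) (h' : Tr J v w) : Tr J u w

/-- normal words -/
def Norm (J : Fin n → Fin n → Prop) : List (Fin n) → Prop
  | [] => True
  | b :: v => Norm J v ∧ ∀ a r, Front J a v r → ¬ J b a → b < a

/-- words with a repetition -/
def Rp (J : Fin n → Fin n → Prop) : List (Fin n) → Prop
  | [] => False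
  | b :: v => Rp J v ∨ (¬ J b b ∧ ∃ r, Front J b v r)

variable {J : Fin n → Fin n → Prop}

lemma Tr.symm (hs : ∀ a b, J a b → J b a) {u v : List (Fin n)} (h : Tr J u v) : Tr J v u := by
  induction h with
  | refl w => exact Tr.refl w
  | swap a b w hJ => exact Tr.swap b a w fun h => hJ (hs _ _ h)
  | cons a w w' h ih => exact Tr.cons _ _ _ ih
  | trans u v w h h' ih ih' => exact Tr.trans _ _ _ ih' ih

lemma Tr.length {u v : List (Fin n)} (h : Tr J u v) : u.length = v.length := by
  induction h with
  | refl w => rfl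
  | swap a b w hJ => simp
  | cons a w w' h ih => simp [ih]
  | trans u v w h h' ih ih' => rw [ih, ih']

lemma front_cons_iff {a b : Fin n} {w r : List (Fin n)} : Front J a (b :: w) r ↔
    (a = b ∧ r = w) ∨ (a ≠ b ∧ ¬ J b a ∧ ∃ r', r = b :: r' ∧ Front J a w r') := by
  constructor
  · intro h
    cases h with
    | head r => exact Or.inl ⟨rfl, rfl⟩
    | cons b w r hne hJ h => exact Or.inr ⟨hne, hJ, r, rfl, h⟩
  · rintro (⟨rfl, rfl⟩ | ⟨hne, hJ, r', rfl, h⟩)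
    · exact Front.head _
    · exact Front.cons _ _ _ hne hJ h

lemma Front.tr (hs : ∀ a b, J a b → J b a) {a : Fin n} {w r : List (Fin n)} (h : Front J a w r) :
    Tr J (a :: r) w := by
  induction h with
  | head r => exact Tr.refl _
  | cons b w r hne hJ h ih =>
    exact Tr.trans _ _ _ (Tr.swap a b r fun h => hJ (hs _ _ h)) (Tr.cons _ _ _ ih)

lemma Front.length {a : Fin n} {w r : List (Fin n)} (h : Front J a w r) :
    w.length = r.length + 1 := by
  induction h with
  | head r => rfl
  | cons b w r hne hJ h ih => simp [ih]

lemma Tr.front (hs : ∀ a b, J a b → J b a) {w w' : List (Fin n)} (h : Tr J w w') :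
    ∀ {a r}, Front J a w r → ∃ r', Front J a w' r' ∧ Tr J r r' := by
  induction h with
  | refl w => intro a r h; exact ⟨r, h, Tr.refl _⟩
  | swap b c w hJ =>
    intro a r h
    by_cases hbc : b = c
    · subst hbc; exact ⟨r, h, Tr.refl _⟩
    rcases front_cons_iff.1 h with ⟨rfl, rfl⟩ | ⟨hne, hJ1, r1, rfl, h1⟩
    · exact ⟨c :: w, Front.cons _ _ _ hbc (fun h => hJ (hs _ _ h)) (Front.head _), Tr.refl _⟩
    rcases front_cons_iff.1 h1 with ⟨rfl, rfl⟩ | ⟨hne2, hJ2, r2, rfl, h2⟩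
    · exact ⟨b :: r1, Front.head _, Tr.refl _⟩
    · exact ⟨c :: b :: r2, Front.cons _ _ _ hne2 hJ2 (Front.cons _ _ _ hne hJ1 h2),
        Tr.swap _ _ _ hJ⟩
  | cons b w w' h ih =>
    intro a r h1
    rcases front_cons_iff.1 h1 with ⟨rfl, rfl⟩ | ⟨hne, hJ1, r1, rfl, h2⟩
    · exact ⟨w', Front.head _, h⟩
    · obtain ⟨r', h3, h4⟩ := ih h2
      exact ⟨b :: r', Front.cons _ _ _ hne hJ1 h3, Tr.cons _ _ _ h4⟩
  | trans u v w h h' ih ih' =>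
    intro a r h1
    obtain ⟨r1, h2, h3⟩ := ih h1
    obtain ⟨r2, h4, h5⟩ := ih' h2
    exact ⟨r2, h4, Tr.trans _ _ _ h3 h5⟩

lemma Tr.rp (hs : ∀ a b, J a b → J b a) {w w' : List (Fin n)} (h : Tr J w w') :
    Rp J w → Rp J w' := by
  induction h with
  | refl w => exact id
  | swap b c w hJ =>
    intro h
    by_cases hbc : b = c
    · subst hbc; exact h
    rcases h with (h | ⟨hc, r, h⟩) | ⟨hb, r, h⟩
    · exact Or.inl (Or.inl h)
    · exact Or.inr ⟨hc, _, Front.cons _ _ _ (Ne.symm hbc) hJ h⟩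
    · rcases front_cons_iff.1 h with ⟨rfl, rfl⟩ | ⟨hne, hJ1, r1, rfl, h1⟩
      · exact absurd rfl hbc
      · exact Or.inl (Or.inr ⟨hb, _, h1⟩)
  | cons a w w' h ih =>
    rintro (h1 | ⟨ha, r, h1⟩)
    · exact Or.inl (ih h1)
    · obtain ⟨r', h2, -⟩ := h.front hs h1
      exact Or.inr ⟨ha, r', h2⟩
  | trans u v w h h' ih ih' => exact fun h => ih' (ih h)

lemma Norm.not_rp {w : List (Fin n)} (h : Norm J w) : ¬ Rp J w := by
  induction w with
  | nil => exact id
  | cons b v ih =>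
    rintro (h1 | ⟨hb, r, h1⟩)
    · exact ih h.1 h1
    · exact lt_irrefl _ (h.2 b r h1 hb)

lemma Norm.unique (hs : ∀ a b, J a b → J b a) : ∀ {w w' : List (Fin n)}, Norm J w → Norm J w' →
    Tr J w w' → w = w' := by
  have hmin : ∀ {b v a r}, Norm J (b :: v) → Front J a (b :: v) r → b ≤ a := by
    intro b v a r h h1
    rcases front_cons_iff.1 h1 with ⟨rfl, rfl⟩ | ⟨hne, hJ1, r1, rfl, h2⟩
    · exact le_rfl
    · exact (h.2 a r1 h2 hJ1).le
  intro w
  induction w with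
  | nil =>
    intro w' _ _ h
    exact (List.length_eq_zero_iff.1 h.length.symm).symm
  | cons b v ih =>
    intro w' hw hw' h
    match w', hw', h with
    | [], _, h => simpa using h.length
    | b' :: v', hw', h =>
      obtain ⟨r1, h1, h1'⟩ := h.front hs (Front.head v)
      obtain ⟨r2, h2, -⟩ := (h.symm hs).front hs (Front.head v')
      have hbb : b = b' := le_antisymm (hmin hw h2) (hmin hw' h1)
      subst hbb
      rcases front_cons_iff.1 h1 with ⟨-, rfl⟩ | ⟨hne, -⟩
      · rw [ih hw.1 hw'.1 h1']
      · exact absurd rfl hne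

lemma exists_norm (hs : ∀ a b, J a b → J b a) : ∀ (r : ℕ) (w : List (Fin n)), w.length = r →
    ¬ Rp J w → ∃ v, Norm J v ∧ Tr J w v := by
  intro r
  induction r with
  | zero =>
    intro w hw _
    obtain rfl := List.length_eq_zero_iff.1 hw
    exact ⟨[], trivial, Tr.refl _⟩
  | succ r ih =>
    intro w hw hrp
    obtain ⟨b, w', rfl⟩ : ∃ b w', w = b :: w' := by
      cases w with
      | nil => simp at hw
      | cons b w' => exact ⟨b, w', rfl⟩
    have hne : (Finset.univ.filter fun a => ∃ r, Front J a (b :: w') r).Nonempty :=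
      ⟨b, by simpa using ⟨_, Front.head _⟩⟩
    obtain ⟨a, ha, hmin⟩ := Finset.exists_min_image _ id hne
    obtain ⟨s, hs1⟩ : ∃ r, Front J a (b :: w') r := by simpa using ha
    have htr := hs1.tr hs
    have hlen : s.length = r := by
      have := hs1.length
      omega
    have hrs : ¬ Rp J (a :: s) := fun h => hrp (htr.rp hs h)
    obtain ⟨v, hv, hsv⟩ := ih s hlen fun h => hrs (Or.inl h)
    refine ⟨a :: v, ⟨hv, ?_⟩, Tr.trans _ _ _ (htr.symm hs) (Tr.cons _ _ _ hsv)⟩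
    intro c t hc hJ
    obtain ⟨t', hc', -⟩ := (hsv.symm hs).front hs hc
    by_cases hca : c = a
    · subst hca
      exact absurd (Or.inr ⟨hJ, t', hc'⟩) hrs
    · obtain ⟨t2, h2, -⟩ := htr.front hs (Front.cons a s t' hca hJ hc')
      exact lt_of_le_of_ne (hmin c (by simpa using ⟨_, h2⟩)) (Ne.symm hca)

lemma crit_iff {P : Fin n → Prop} {v : List (Fin n)} :
    crit J P v ↔ (∀ a r, Front J a v r → P a) ∧ Norm J v := by
  induction v generalizing P with
  | nil =>
    simp only [crit, Norm, and_true, true_iff]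
    intro a r h; cases h
  | cons y v ih =>
    simp only [crit, Norm, ih, stp]
    constructor
    · rintro ⟨h1, h2, h3⟩
      refine ⟨?_, h3, ?_⟩
      · intro a r h
        rcases front_cons_iff.1 h with ⟨rfl, rfl⟩ | ⟨hne, hJ1, r1, rfl, h1⟩
        · exact h1
        · exact ((h2 a r1 h1).resolve_left hJ1).1
      · intro a r h hJ
        exact ((h2 a r h).resolve_left hJ).2
    · rintro ⟨h1, h2, h3⟩
      refine ⟨h1 y v (Front.head _), ?_, h2⟩
      intro a r h
      by_cases hJ : J y a
      · exact Or.inl hJ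
      · have hlt := h3 a r h hJ
        exact Or.inr ⟨h1 a _ (Front.cons _ _ _ hlt.ne' hJ h), hlt⟩

lemma Tr.app_left {w w' : List (Fin n)} (u : List (Fin n)) (h : Tr J w w') :
    Tr J (u ++ w) (u ++ w') := by
  induction u with
  | nil => exact h
  | cons a u ih => exact Tr.cons _ _ _ ih

lemma rp_prefix (u : List (Fin n)) {w : List (Fin n)} (h : Rp J w) : Rp J (u ++ w) := by
  induction u with
  | nil => exact h
  | cons a u ih => exact Or.inl ih

end Words

section WordCount
open ASG
variable {e n : ℕ} {k : Type} [Field k] {ord : LinearOrder (Fin n →₀ ℕ)} {α : Fin n → M e}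

lemma Jrel_symm (a b : Fin n) (h : Jrel k ord α a b) : Jrel k ord α b a := by
  unfold Jrel at *; rwa [add_comm]

lemma ofFn_split {r : ℕ} (w : Fin r → Fin n) (t : ℕ) (h1 : t < r) (h2 : t + 1 < r) :
    List.ofFn w = (List.ofFn w).take t ++ w ⟨t, h1⟩ :: w ⟨t+1, h2⟩ :: (List.ofFn w).drop (t+2) := by
  conv_lhs => rw [← List.take_append_drop t (List.ofFn w)]
  rw [List.drop_eq_getElem_cons (by simpa using h1), List.drop_eq_getElem_cons (by simpa using h2)]
  simp

lemma swap_tr {r : ℕ} {w w' : Fin r → Fin n} (h : SwapStep k ord α r w w') :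
    Tr (Jrel k ord α) (List.ofFn w) (List.ofFn w') := by
  obtain ⟨t, h1, h2, hJ, rfl⟩ := h
  set w' := Function.update (Function.update w ⟨t, h1⟩ (w ⟨t + 1, h2⟩)) ⟨t + 1, h2⟩ (w ⟨t, h1⟩) with hw'
  rw [ofFn_split w t h1 h2, ofFn_split w' t h1 h2]
  have e1 : w' ⟨t, h1⟩ = w ⟨t+1, h2⟩ := by
    simp [hw', Function.update_apply]
  have e2 : w' ⟨t+1, h2⟩ = w ⟨t, h1⟩ := by
    simp [hw']
  have e3 : (List.ofFn w').take t = (List.ofFn w).take t := by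
    apply List.ext_getElem
    · simp
    · intro j hj hj'
      have : j < t := by simp at hj; omega
      simp [hw', Function.update_apply]
      split_ifs <;> first | rfl | omega
  have e4 : (List.ofFn w').drop (t+2) = (List.ofFn w).drop (t+2) := by
    apply List.ext_getElem
    · simp
    · intro j hj hj'
      simp [hw', Function.update_apply]
      split_ifs <;> first | rfl | omega
  rw [e1, e2, e3, e4]
  exact Tr.app_left _ (Tr.swap _ _ _ hJ)

lemma eqv_tr {r : ℕ} {w w' : Fin r → Fin n} (h : Relation.EqvGen (SwapStep k ord α r) w w') :
    Tr (Jrel k ord α) (List.ofFn w) (List.ofFn w') := by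
  induction h with
  | rel _ _ h => exact swap_tr h
  | refl => exact Tr.refl _
  | symm _ _ _ ih => exact ih.symm Jrel_symm
  | trans _ _ _ _ _ ih ih2 => exact Tr.trans _ _ _ ih ih2

/-- word as function -/
def fn {r : ℕ} (l : List (Fin n)) (h : l.length = r) : Fin r → Fin n := fun t => l[t.1]'(by omega)

lemma ofFn_fn {r : ℕ} (l : List (Fin n)) (h : l.length = r) : List.ofFn (fn l h) = l := by
  subst h
  exact List.ofFn_getElem

lemma fn_ofFn {r : ℕ} (w : Fin r → Fin n) : fn (List.ofFn w) (by simp) = w := by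
  ext t; simp [fn]

lemma fn_congr {r : ℕ} {l l' : List (Fin n)} (h : l = l') (h1 : l.length = r) (h2 : l'.length = r) :
    fn l h1 = fn l' h2 := by
  subst h; rfl

lemma tr_eqv {l l' : List (Fin n)} (h : Tr (Jrel k ord α) l l') :
    ∀ (r : ℕ) (u : List (Fin n)) (h1 : (u ++ l).length = r) (h2 : (u ++ l').length = r),
    Relation.EqvGen (SwapStep k ord α r) (fn (u ++ l) h1) (fn (u ++ l') h2) := by
  induction h with
  | refl w => intro r u h1 h2; exact Relation.EqvGen.refl _
  | swap a b w hJ =>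
    intro r u h1 h2
    apply Relation.EqvGen.rel
    simp only [List.length_append, List.length_cons] at h1 h2
    refine ⟨u.length, by omega, by omega, ?_, ?_⟩
    · simpa [fn, List.getElem_append] using hJ
    · funext ⟨j, hj⟩
      simp only [fn, List.getElem_append, Function.update_apply, Fin.mk.injEq, lt_irrefl, dif_neg,
        not_false_eq_true, Nat.sub_self, List.getElem_cons_zero]
      rcases lt_trichotomy j u.length with hlt | rfl | hgt
      · have q1 : j ≠ u.length := by omega
        have q2 : j ≠ u.length + 1 := by omega
        simp [hlt, q1, q2]
      · simp
      · obtain ⟨c, rfl⟩ : ∃ c, j = u.length + 1 + c := ⟨j - (u.length + 1), by omega⟩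
        have q1 : u.length + 1 + c - u.length = c + 1 := by omega
        cases c with
        | zero => simp
        | succ c =>
          have q3 : ¬ (u.length + 1 + (c + 1) = u.length) := by omega
          have q4 : ¬ (u.length + 1 + (c + 1) < u.length) := by omega
          simp [q1, q3, q4]
  | cons a w w' h ih =>
    intro r u h1 h2
    have := ih r (u ++ [a]) (by simpa using h1) (by simpa using h2)
    rw [fn_congr (show u ++ a :: w = u ++ [a] ++ w by simp) h1 (by simpa using h1),
      fn_congr (show u ++ a :: w' = u ++ [a] ++ w' by simp) h2 (by simpa using h2)]
    exact this
  | trans x y z h h' ih ih' =>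
    intro r u h1 h2
    have hl := h.length
    have h3 : (u ++ y).length = r := by
      rw [List.length_append] at *
      omega
    exact Relation.EqvGen.trans _ _ _ (ih r u h1 h3) (ih' r u h3 h2)

lemma stutter_rp {r : ℕ} {w : Fin r → Fin n} (h : Stutter k ord α r w) :
    Rp (Jrel k ord α) (List.ofFn w) := by
  obtain ⟨t, h1, h2, he, hJ⟩ := h
  rw [ofFn_split w t h1 h2]
  have hf : Front (Jrel k ord α) (w ⟨t, h1⟩) (w ⟨t+1, h2⟩ :: (List.ofFn w).drop (t+2))
      ((List.ofFn w).drop (t+2)) := by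
    rw [he]; exact Front.head _
  exact rp_prefix _ (Or.inr ⟨hJ, _, hf⟩)

lemma rp_stutter (l : List (Fin n)) (h : Rp (Jrel k ord α) l) :
    ∃ u a v, Tr (Jrel k ord α) l (u ++ a :: a :: v) ∧ ¬ Jrel k ord α a a := by
  induction l with
  | nil => exact h.elim
  | cons b l ih =>
    rcases h with h | ⟨hb, r, h⟩
    · obtain ⟨u, a, v, h1, h2⟩ := ih h
      exact ⟨b :: u, a, v, Tr.cons _ _ _ h1, h2⟩
    · exact ⟨[], b, r, Tr.cons _ _ _ ((h.tr Jrel_symm).symm Jrel_symm), hb⟩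

lemma noStutter_iff {r : ℕ} (w : Fin r → Fin n) :
    NoStutterCl k ord α r w ↔ ¬ Rp (Jrel k ord α) (List.ofFn w) := by
  constructor
  · intro h hrp
    obtain ⟨u, a, v, h1, h2⟩ := rp_stutter _ hrp
    have hl : (u ++ a :: a :: v).length = r := by rw [← h1.length]; simp
    have := tr_eqv h1 r [] (by simp) hl
    simp only [List.nil_append, fn_ofFn] at this
    refine h _ this ⟨u.length, ?_, ?_, ?_⟩
    · simp at hl; omega
    · simp at hl; omega
    · simpa [fn, List.getElem_append] using h2
  · intro h w' hw' hst
    exact h (((eqv_tr hw').symm Jrel_symm).rp Jrel_symm (stutter_rp hst))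

lemma tr_content {l l' : List (Fin n)} (h : Tr (Jrel k ord α) l l') :
    (l.map α).sum = (l'.map α).sum := by
  induction h with
  | refl w => rfl
  | swap a b w hJ => simp [add_left_comm]
  | cons a w w' h ih => simp [ih]
  | trans x y z h h' ih ih' => rw [ih, ih']

lemma ofFn_content {r : ℕ} (w : Fin r → Fin n) : ((List.ofFn w).map α).sum = ∑ t, α (w t) := by
  rw [List.map_ofFn, List.sum_ofFn]; rfl

theorem count_classes (r : ℕ) (lam : M e) :
    Nat.card {v : List (Fin n) // Norm (Jrel k ord α) v ∧ v.length = r ∧ (v.map α).sum = lam}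
      = classCount k ord α r lam := by
  unfold classCount
  let f : {v : List (Fin n) // Norm (Jrel k ord α) v ∧ v.length = r ∧ (v.map α).sum = lam} →
      WordClasses k ord α r lam := fun v => Quot.mk _ ⟨fn v.1 v.2.2.1, by
        rw [← ofFn_content, ofFn_fn]; exact v.2.2.2, by
        rw [noStutter_iff, ofFn_fn]; exact v.2.1.not_rp⟩
  apply Nat.card_eq_of_bijective f
  constructor
  · rintro ⟨v, hv⟩ ⟨v', hv'⟩ h
    have h1 := Quot.eqvGen_exact h
    have h2 : Tr (Jrel k ord α) v v' := by
      have : ∀ a b : { w : Fin r → Fin n // (∑ t, α (w t)) = lam ∧ NoStutterCl k ord α r w },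
          Relation.EqvGen (fun a b : { w : Fin r → Fin n // (∑ t, α (w t)) = lam ∧ NoStutterCl k ord α r w } =>
          Relation.EqvGen (SwapStep k ord α r) a.1 b.1) a b →
          Tr (Jrel k ord α) (List.ofFn a.1) (List.ofFn b.1) := by
        intro a b h
        induction h with
        | rel _ _ h => exact eqv_tr h
        | refl => exact Tr.refl _
        | symm _ _ _ ih => exact ih.symm Jrel_symm
        | trans _ _ _ _ _ ih ih' => exact Tr.trans _ _ _ ih ih'
      have := this _ _ h1
      simpa only [ofFn_fn] using this
    exact Subtype.ext (Norm.unique Jrel_symm hv.1 hv'.1 h2)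
  · intro q
    induction q using Quot.ind with
    | _ a =>
    obtain ⟨w, hw, hst⟩ := a
    obtain ⟨v, hv, htr⟩ := exists_norm Jrel_symm r (List.ofFn w) (by simp) ((noStutter_iff w).1 hst)
    have hl : v.length = r := by rw [← htr.length]; simp
    refine ⟨⟨v, hv, hl, by rw [← tr_content htr, ofFn_content, hw]⟩, ?_⟩
    apply Quot.sound
    have := tr_eqv (htr.symm Jrel_symm) r [] hl (by simp)
    simpa only [List.nil_append, fn_ofFn] using this

end WordCount
end ASGM

namespace ASGM
open Finsupp

section Toric
open ASG
variable {e n : ℕ}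

/-- the content of a monomial -/
def cont (α : Fin n → M e) : (Fin n →₀ ℕ) →ₗ[ℕ] M e := Finsupp.linearCombination ℕ α

lemma cont_single (α : Fin n → M e) (a : Fin n) : cont α (single a 1) = α a := by
  simp [cont]

/-- what we need to know about the toric ideal -/
structure Dat (α : Fin n → M e) (J : Fin n → Fin n → Prop) (ord : LinearOrder (Fin n →₀ ℕ)) :
    Prop where
  cont0 : ∀ m, cont α m = 0 → m = 0
  ex : ∀ μ ∈ sg α, ∃ m, Cq J m ∧ cont α m = μ
  min : ∀ m m', Cq J m → cont α m' = cont α m → ord.le m m'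
  deg : ∀ m m', Cq J m → cont α m' = cont α m → Finsupp.degree m' ≤ Finsupp.degree m

lemma cont_mem (α : Fin n → M e) (m : Fin n →₀ ℕ) : cont α m ∈ sg α := by
  induction m using Finsupp.induction_linear with
  | zero => simp
  | add f g hf hg => rw [map_add]; exact add_mem hf hg
  | single a b =>
    rw [cont, Finsupp.linearCombination_single]
    exact AddSubmonoid.nsmul_mem _ (AddSubmonoid.subset_closure (Set.mem_range_self a)) b

lemma exists_cont {α : Fin n → M e} {μ : M e} (h : μ ∈ sg α) : ∃ m, cont α m = μ := by
  induction h using AddSubmonoid.closure_induction with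
  | mem x hx => obtain ⟨a, rfl⟩ := hx; exact ⟨_, cont_single α a⟩
  | zero => exact ⟨0, map_zero _⟩
  | add x y _ _ hx hy =>
    obtain ⟨a, rfl⟩ := hx
    obtain ⟨b, rfl⟩ := hy
    exact ⟨a + b, map_add _ _ _⟩

lemma degree_le_cont {α : Fin n → M e} (hα : ∀ i, α i ≠ 0) (m : Fin n →₀ ℕ) :
    Finsupp.degree m ≤ Finsupp.degree (cont α m) := by
  induction m using Finsupp.induction_linear with
  | zero => simp
  | add f g hf hg => simp only [map_add]; omega
  | single a b =>
    rw [cont, Finsupp.linearCombination_single, Finsupp.degree_single, map_nsmul]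
    have : 1 ≤ Finsupp.degree (α a) := by
      rw [Nat.one_le_iff_ne_zero]
      intro h
      exact hα a ((Finsupp.degree_eq_zero_iff _).1 h)
    rw [smul_eq_mul]
    nlinarith

lemma cont_eq_zero {α : Fin n → M e} (hα : ∀ i, α i ≠ 0) (m : Fin n →₀ ℕ) (h : cont α m = 0) :
    m = 0 := by
  have := degree_le_cont hα m
  rw [h] at this
  apply (Finsupp.degree_eq_zero_iff _).1
  simpa using this

lemma fiber_finite {α : Fin n → M e} (hα : ∀ i, α i ≠ 0) (μ : M e) :
    {m | cont α m = μ}.Finite := by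
  apply (Set.finite_Iic (Finsupp.equivFunOnFinite.symm fun _ : Fin n => Finsupp.degree μ)).subset
  intro m hm i
  have h1 := degree_le_cont hα m
  have hm' : cont α m = μ := hm
  rw [hm'] at h1
  have h2 := Finsupp.le_degree i m
  simp only [Finsupp.equivFunOnFinite_symm_apply_apply]
  omega

lemma exists_single_add {m : Fin n →₀ ℕ} (h : m ≠ 0) : ∃ a m', m = single a 1 + m' := by
  obtain ⟨a, ha⟩ := Finsupp.ne_iff.1 h
  have : single a 1 ≤ m := by
    rw [Finsupp.single_le_iff]
    exact Nat.one_le_iff_ne_zero.2 ha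
  obtain ⟨c, hc⟩ := exists_add_of_le this
  exact ⟨a, c, hc⟩

lemma cont_eq_gen {α : Fin n → M e} (hα : ∀ i, α i ≠ 0) (hinj : Function.Injective α)
    (hirr : ∀ i, ¬ ∃ a ∈ sg α, ∃ b ∈ sg α, a ≠ 0 ∧ b ≠ 0 ∧ a + b = α i) (a : Fin n)
    (m : Fin n →₀ ℕ) (h : cont α m = α a) : m = single a 1 := by
  have hm : m ≠ 0 := by
    rintro rfl
    exact hα a (by rw [← h, map_zero])
  obtain ⟨b, m', rfl⟩ := exists_single_add hm
  have hm' : m' = 0 := by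
    by_contra hne
    refine hirr a ⟨α b, ?_, cont α m', cont_mem α m', hα b, fun h => hne (cont_eq_zero hα _ h), ?_⟩
    · rw [← cont_single α b]; exact cont_mem _ _
    · rw [← h, map_add, cont_single]
  subst hm'
  rw [add_zero, cont_single] at h
  rw [hinj h, add_zero]

/-- standard monomials -/
def St (α : Fin n → M e) (ord : LinearOrder (Fin n →₀ ℕ)) (m : Fin n →₀ ℕ) : Prop :=
  ∀ m', cont α m' = cont α m → ord.le m m'

lemma exists_st {α : Fin n → M e} (hα : ∀ i, α i ≠ 0) (ord : LinearOrder (Fin n →₀ ℕ)) {μ : M e}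
    (h : μ ∈ sg α) : ∃ m, St α ord m ∧ cont α m = μ := by
  obtain ⟨m0, h0⟩ := exists_cont h
  obtain ⟨m, hm, hmin⟩ := @Set.exists_min_image _ _ ord {m | cont α m = μ} id
    (fiber_finite hα μ) ⟨m0, h0⟩
  have hm' : cont α m = μ := hm
  exact ⟨m, fun m' h' => hmin m' (show cont α m' = μ by rw [h', hm']), hm'⟩

lemma aeval_mono (k : Type) [Field k] (α : Fin n → M e) (m : Fin n →₀ ℕ) (c : k) :
    MvPolynomial.aeval (R := k)
      (fun i : Fin n => (MvPolynomial.monomial (α i) 1 : MvPolynomial (Fin e) k))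
      (MvPolynomial.monomial m c) = MvPolynomial.monomial (cont α m) c := by
  rw [MvPolynomial.aeval_monomial, cont, Finsupp.linearCombination_apply, Finsupp.sum,
    MvPolynomial.monomial_sum_index, Finsupp.prod]
  simp [MvPolynomial.monomial_pow, MvPolynomial.algebraMap_eq]

lemma cancel {k : Type} [Field k] {α : Fin n → M e} {f : MvPolynomial (Fin n) k}
    (hf : f ∈ toricIdeal k α) {mo : Fin n →₀ ℕ} (hmo : mo ∈ f.support) :
    ∃ m' ∈ f.support, m' ≠ mo ∧ cont α m' = cont α mo := by
  by_contra hcon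
  push Not at hcon
  have h1 : MvPolynomial.aeval (R := k)
    (fun i : Fin n => (MvPolynomial.monomial (α i) 1 : MvPolynomial (Fin e) k)) f = 0 := hf
  rw [MvPolynomial.as_sum f, map_sum] at h1
  have h2 := congrArg (MvPolynomial.coeff (cont α mo)) h1
  simp only [aeval_mono, MvPolynomial.coeff_sum, MvPolynomial.coeff_monomial,
    MvPolynomial.coeff_zero] at h2
  rw [Finset.sum_eq_single mo] at h2
  · simp at h2
    exact (MvPolynomial.mem_support_iff.1 hmo) h2
  · intro b hb hne
    rw [if_neg (hcon b hb hne)]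
  · intro h; exact absurd hmo h

lemma initial_eq (k : Type) [Field k] (ord : LinearOrder (Fin n →₀ ℕ)) (α : Fin n → M e) :
    initialIdeal k ord α = Ideal.span ((fun s => MvPolynomial.monomial s (1 : k)) ''
      {mo | ∃ f ∈ toricIdeal k α, f ≠ 0 ∧ mo ∈ f.support ∧ ∀ m' ∈ f.support, ord.le m' mo}) := by
  unfold initialIdeal
  congr 1
  ext p
  constructor
  · rintro ⟨f, hf, h0, mo, ⟨h1, h2⟩, rfl⟩
    exact ⟨mo, ⟨f, hf, h0, h1, h2⟩, rfl⟩
  · rintro ⟨mo, ⟨f, hf, h0, h1, h2⟩, rfl⟩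
    exact ⟨f, hf, h0, mo, ⟨h1, h2⟩, rfl⟩

lemma mono_mem_span {k : Type} [Field k] (s : Set (Fin n →₀ ℕ)) (m : Fin n →₀ ℕ) :
    MvPolynomial.monomial m (1 : k) ∈ Ideal.span ((fun s => MvPolynomial.monomial s (1 : k)) '' s)
      ↔ ∃ g ∈ s, g ≤ m := by
  rw [MvPolynomial.mem_ideal_span_monomial_image]
  simp [MvPolynomial.support_monomial]

lemma St.of_le {α : Fin n → M e} {ord : LinearOrder (Fin n →₀ ℕ)} (hord : IsTermOrder ord)
    {g m : Fin n →₀ ℕ} (h : St α ord m) (hle : g ≤ m) : St α ord g := by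
  obtain ⟨c, rfl⟩ := exists_add_of_le hle
  intro g' hg'
  by_contra hcon
  have h1 : ord.le g' g := (ord.le_total g' g).resolve_right hcon
  have h2 := hord.2 _ _ c h1
  have h3 := h (g' + c) (by rw [map_add, map_add, hg'])
  have h4 := ord.le_antisymm _ _ h2 h3
  rw [add_right_cancel h4] at hcon
  exact hcon (ord.le_refl _)

lemma mono_mem_initial {k : Type} [Field k] {ord : LinearOrder (Fin n →₀ ℕ)}
    (hord : IsTermOrder ord) {α : Fin n → M e} (m : Fin n →₀ ℕ) :
    MvPolynomial.monomial m (1 : k) ∈ initialIdeal k ord α ↔ ¬ St α ord m := by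
  rw [initial_eq, mono_mem_span]
  constructor
  · rintro ⟨mo, ⟨f, hf, h0, h1, h2⟩, hle⟩ hst
    have hst' := hst.of_le hord hle
    obtain ⟨m', hm', hne, hc⟩ := cancel hf h1
    exact hne (ord.le_antisymm _ _ (h2 m' hm') (hst' m' hc))
  · intro h
    unfold St at h
    obtain ⟨m', h'⟩ := not_forall.1 h
    obtain ⟨hc, hlt⟩ := Classical.not_imp.1 h'
    have hle : ord.le m' m := (ord.le_total m' m).resolve_right hlt
    have hne : m' ≠ m := by rintro rfl; exact hlt (ord.le_refl _)
    set f : MvPolynomial (Fin n) k := MvPolynomial.monomial m 1 - MvPolynomial.monomial m' 1 with hf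
    have hms : m ∈ f.support := by
      rw [MvPolynomial.mem_support_iff, hf, MvPolynomial.coeff_sub]
      simp [MvPolynomial.coeff_monomial, hne]
    refine ⟨m, ⟨f, ?_, ?_, hms, ?_⟩, le_rfl⟩
    · change MvPolynomial.aeval (R := k)
        (fun i : Fin n => (MvPolynomial.monomial (α i) 1 : MvPolynomial (Fin e) k)) f = 0
      rw [hf, map_sub, aeval_mono, aeval_mono, hc, sub_self]
    · intro h0
      rw [h0] at hms
      simp at hms
    · intro x hx
      rw [MvPolynomial.mem_support_iff, hf, MvPolynomial.coeff_sub, MvPolynomial.coeff_monomial,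
        MvPolynomial.coeff_monomial] at hx
      by_cases h1 : m = x
      · subst h1; exact ord.le_refl _
      · by_cases h2 : m' = x
        · subst h2; exact hle
        · simp [h1, h2] at hx

lemma st_iff {k : Type} [Field k] {ord : LinearOrder (Fin n →₀ ℕ)}
    (hord : IsTermOrder ord) {α : Fin n → M e} (hα : ∀ i, α i ≠ 0) (hinj : Function.Injective α)
    (hirr : ∀ i, ¬ ∃ a ∈ sg α, ∃ b ∈ sg α, a ≠ 0 ∧ b ≠ 0 ∧ a + b = α i)
    (hGB : HasGB k ord α 2) (m : Fin n →₀ ℕ) : St α ord m ↔ Cq (Jrel k ord α) m := by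
  constructor
  · intro h a b hab hJ
    exact (mono_mem_initial hord _).1 hJ (h.of_le hord hab)
  · intro h
    by_contra hns
    have h1 := (mono_mem_initial (k := k) hord m).2 hns
    obtain ⟨G, hG, he⟩ := hGB
    rw [← he, mono_mem_span] at h1
    obtain ⟨g, hg, hle⟩ := h1
    have hgi : MvPolynomial.monomial g (1 : k) ∈ initialIdeal k ord α := by
      rw [← he]; exact Ideal.subset_span ⟨g, hg, rfl⟩
    have hgst := (mono_mem_initial hord g).1 hgi
    have hdeg : Finsupp.degree g ≤ 2 := hG g hg
    have hg0 : g ≠ 0 := by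
      rintro rfl
      apply hgst
      intro m' h'
      rw [map_zero] at h'
      rw [cont_eq_zero hα m' h']
      exact ord.le_refl _
    obtain ⟨a, g1, rfl⟩ := exists_single_add hg0
    have hg1 : g1 ≠ 0 := by
      rintro rfl
      apply hgst
      intro m' h'
      rw [add_zero, cont_single] at h'
      rw [cont_eq_gen hα hinj hirr a m' h', add_zero]
      exact ord.le_refl _
    obtain ⟨b, g2, rfl⟩ := exists_single_add hg1
    have hg2 : g2 = 0 := by
      simp only [map_add, Finsupp.degree_single] at hdeg
      apply (Finsupp.degree_eq_zero_iff _).1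
      omega
    subst hg2
    rw [add_zero] at *
    exact h a b hle hgi

theorem mkDat {k : Type} [Field k] {ord : LinearOrder (Fin n →₀ ℕ)}
    (hord : IsTermOrder ord) {α : Fin n → M e} (hα : ∀ i, α i ≠ 0) (hinj : Function.Injective α)
    (hirr : ∀ i, ¬ ∃ a ∈ sg α, ∃ b ∈ sg α, a ≠ 0 ∧ b ≠ 0 ∧ a + b = α i)
    (hGB : HasGB k ord α 2) : Dat α (Jrel k ord α) ord := by
  have hst := st_iff hord hα hinj hirr hGB
  refine ⟨cont_eq_zero hα, ?_, ?_, ?_⟩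
  · intro μ hμ
    obtain ⟨m, h1, h2⟩ := exists_st hα ord hμ
    exact ⟨m, (hst m).1 h1, h2⟩
  · intro m m' h1 h2
    exact (hst m).2 h1 m' h2
  · intro m0 m' h0 hc'
    by_contra hcon
    have hfin : {m | cont α m = cont α m0 ∧ ¬ Finsupp.degree m ≤ Finsupp.degree m0}.Finite :=
      (fiber_finite hα (cont α m0)).subset fun m hm => hm.1
    obtain ⟨m, ⟨hm1, hm2⟩, hmin⟩ := @Set.exists_min_image _ _ ord _ id hfin ⟨m', hc', hcon⟩
    by_cases hs : St α ord m
    · have := ord.le_antisymm _ _ (hs m0 hm1.symm) ((hst m0).2 h0 m hm1)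
      exact hm2 (by rw [this])
    · rw [hst] at hs
      unfold Cq at hs
      push Not at hs
      obtain ⟨a, b, hle, hJ⟩ := hs
      obtain ⟨c, rfl⟩ := exists_add_of_le hle
      have hns := (mono_mem_initial hord _).1 hJ
      obtain ⟨s, hs1, hs2⟩ := exists_st hα ord (cont_mem α (single a 1 + single b 1))
      have hsle : ord.le s (single a 1 + single b 1) := hs1 _ hs2.symm
      have hsne : s ≠ single a 1 + single b 1 := by rintro rfl; exact hns hs1
      have hga : α a ∈ sg α := AddSubmonoid.subset_closure ⟨a, rfl⟩
      have hgb : α b ∈ sg α := AddSubmonoid.subset_closure ⟨b, rfl⟩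
      rw [map_add, cont_single, cont_single] at hs2
      have hdeg : 2 ≤ Finsupp.degree s := by
        have hs0 : s ≠ 0 := by
          rintro rfl
          rw [map_zero] at hs2
          have := (add_eq_zero.1 hs2.symm).1
          exact hα a this
        obtain ⟨x, s1, rfl⟩ := exists_single_add hs0
        have hs10 : s1 ≠ 0 := by
          rintro rfl
          rw [add_zero, cont_single] at hs2
          exact hirr x ⟨α a, hga, α b, hgb, hα a, hα b, hs2.symm⟩
        obtain ⟨y, s2, rfl⟩ := exists_single_add hs10
        simp only [map_add, Finsupp.degree_single]
        omega
      have hcs : cont α (s + c) = cont α (single a 1 + single b 1 + c) := by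
        rw [map_add, map_add, map_add, hs2, cont_single, cont_single]
      have h5 := hmin (s + c) ⟨hcs.trans hm1, by
        simp only [map_add, Finsupp.degree_single] at hm2 ⊢
        omega⟩
      have h6 := hord.2 _ _ c hsle
      exact hsne (add_right_cancel (ord.le_antisymm _ _ h6 h5))

end Toric
end ASGM

namespace ASGM
open Finsupp

section Chains
open ASG
variable {e n : ℕ} {α : Fin n → M e} {J : Fin n → Fin n → Prop} {ord : LinearOrder (Fin n →₀ ℕ)}

/-- partial sums of the contents of a list of monomials -/
def ch (α : Fin n → M e) : M e → List (Mo n) → Finset (M e)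
  | p, [] => {p}
  | p, m :: Q => insert p (ch α (p + cont α m) Q)

lemma ch_start (p : M e) (Q : List (Mo n)) : p ∈ ch α p Q := by
  cases Q <;> simp [ch]

lemma ch_end (Q : List (Mo n)) : ∀ p : M e, p + cont α Q.sum ∈ ch α p Q := by
  induction Q with
  | nil => intro p; simp [ch]
  | cons m Q ih =>
    intro p
    have := ih (p + cont α m)
    rw [List.sum_cons, map_add, ← add_assoc]
    exact Finset.mem_insert_of_mem this

lemma ch_ge (Q : List (Mo n)) : ∀ (p x : M e), x ∈ ch α p Q → ∃ m, x = p + cont α m := by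
  induction Q with
  | nil =>
    intro p x hx
    exact ⟨0, by simpa [ch] using hx⟩
  | cons m Q ih =>
    intro p x hx
    rcases Finset.mem_insert.1 hx with rfl | hx
    · exact ⟨0, by simp⟩
    · obtain ⟨m', rfl⟩ := ih _ _ hx
      exact ⟨m + m', by rw [map_add, add_assoc]⟩

lemma ch_le (Q : List (Mo n)) : ∀ (p x : M e), x ∈ ch α p Q → sgLE α x (p + cont α Q.sum) := by
  induction Q with
  | nil =>
    intro p x hx
    refine ⟨0, zero_mem _, ?_⟩
    have : x = p := by simpa [ch] using hx
    simp [this]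
  | cons m Q ih =>
    intro p x hx
    rcases Finset.mem_insert.1 hx with rfl | hx
    · exact ⟨_, cont_mem α _, rfl⟩
    · have := ih _ _ hx
      rwa [List.sum_cons, map_add, ← add_assoc]

lemma ch_notMem (D : Dat α J ord) (p : M e) {m : Mo n} (hm : m ≠ 0) (Q : List (Mo n)) :
    p ∉ ch α (p + cont α m) Q := by
  intro h
  obtain ⟨m', h'⟩ := ch_ge _ _ _ h
  rw [add_assoc, ← map_add] at h'
  have h0 : cont α (m + m') = 0 := by
    have : p + 0 = p + cont α (m + m') := by rw [add_zero]; exact h'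
    exact (add_left_cancel this).symm
  have := D.cont0 _ h0
  exact hm (add_eq_zero.1 this).1

lemma ch_card (D : Dat α J ord) (Q : List (Mo n)) : ∀ (p : M e), (∀ m ∈ Q, m ≠ 0) →
    (ch α p Q).card = Q.length + 1 := by
  induction Q with
  | nil => intro p _; simp [ch]
  | cons m Q ih =>
    intro p h
    rw [ch, Finset.card_insert_of_notMem (ch_notMem D p (h m (by simp)) Q),
      ih _ fun m' hm' => h m' (by simp [hm'])]
    simp

lemma ch_chain (Q : List (Mo n)) : ∀ (p : M e), ∀ x ∈ ch α p Q, ∀ y ∈ ch α p Q, cmp2 α x y := by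
  induction Q with
  | nil =>
    intro p x hx y hy
    have h1 : x = p := by simpa [ch] using hx
    have h2 : y = p := by simpa [ch] using hy
    exact Or.inl ⟨0, zero_mem _, by rw [h1, h2, add_zero]⟩
  | cons m Q ih =>
    intro p x hx y hy
    have key : ∀ z ∈ ch α p (m :: Q), sgLE α p z := by
      intro z hz
      obtain ⟨m', rfl⟩ := ch_ge _ _ _ hz
      exact ⟨_, cont_mem α m', rfl⟩
    rcases Finset.mem_insert.1 hx with rfl | hx'
    · exact Or.inl (key y hy)
    rcases Finset.mem_insert.1 hy with rfl | hy'
    · exact Or.inr (key x hx)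
    · exact ih _ x hx' y hy'

lemma sgLE_antisymm {x y : M e} (h : sgLE α x y) (h' : sgLE α y x) : x = y := by
  obtain ⟨a, -, rfl⟩ := h
  obtain ⟨b, -, hb⟩ := h'
  rw [add_assoc] at hb
  have : a + b = 0 := by
    have h2 : x + (a + b) = x + 0 := by rw [add_zero]; exact hb
    exact add_left_cancel h2
  rw [(add_eq_zero.1 this).1, add_zero]

lemma Dat.uniq (D : Dat α J ord) {m m' : Mo n} (h : Cq J m) (h' : Cq J m')
    (hc : cont α m = cont α m') : m = m' :=
  ord.le_antisymm _ _ (D.min m m' h hc.symm) (D.min m' m h' hc)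

lemma ch_inj (D : Dat α J ord) (Q : List (Mo n)) : ∀ (p : M e) (Q' : List (Mo n)), WF J Q → WF J Q' →
    ch α p Q = ch α p Q' → Q = Q' := by
  induction Q with
  | nil =>
    intro p Q' h h' he
    have h1 := ch_card D Q' p fun m hm => (h' m hm).1
    rw [← he] at h1
    simp only [ch, Finset.card_singleton] at h1
    exact (List.length_eq_zero_iff.1 (by omega)).symm
  | cons m Q ih =>
    intro p Q' h h' he
    cases Q' with
    | nil =>
      have h1 := ch_card D (m :: Q) p fun m hm => (h m hm).1
      rw [he] at h1
      simp [ch] at h1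
    | cons m' Q' =>
      have e1 : ch α (p + cont α m) Q = ch α (p + cont α m') Q' := by
        have h1 := ch_notMem D p (h m (by simp)).1 Q
        have h2 := ch_notMem D p (h' m' (by simp)).1 Q'
        rw [← Finset.erase_insert h1, ← Finset.erase_insert h2]
        exact congrArg (fun S => Finset.erase S p) he
      have h3 : p + cont α m = p + cont α m' := by
        apply sgLE_antisymm (α := α)
        · have h4 := ch_start (α := α) (p + cont α m') Q'
          rw [← e1] at h4
          obtain ⟨x, hx⟩ := ch_ge _ _ _ h4
          exact ⟨_, cont_mem α x, hx.symm⟩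
        · have h4 := ch_start (α := α) (p + cont α m) Q
          rw [e1] at h4
          obtain ⟨x, hx⟩ := ch_ge _ _ _ h4
          exact ⟨_, cont_mem α x, hx.symm⟩
      have h5 := D.uniq (h m (by simp)).2 (h' m' (by simp)).2 (add_left_cancel h3)
      subst h5
      rw [ih _ Q' (fun x hx => h x (by simp [hx])) (fun x hx => h' x (by simp [hx])) e1]

lemma ch_surj (D : Dat α J ord) : ∀ (r : ℕ) (S : Finset (M e)) (p y : M e), S.card = r →
    p ∈ S → y ∈ S → (∀ μ ∈ S, sgLE α p μ ∧ sgLE α μ y) → (S : Set (M e)).Pairwise (cmp2 α) →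
    ∃ Q, WF J Q ∧ ch α p Q = S ∧ p + cont α Q.sum = y := by
  intro r
  induction r with
  | zero =>
    intro S p y hr hp
    rw [Finset.card_eq_zero.1 hr] at hp
    simp at hp
  | succ r ih =>
    intro S p y hr hp hy hS hch
    by_cases hE : S.erase p = ∅
    · refine ⟨[], by intro m hm; simp at hm, ?_, ?_⟩
      · rw [← Finset.insert_erase hp, hE]; rfl
      · have : y = p := by
          by_contra hne
          have : y ∈ S.erase p := Finset.mem_erase.2 ⟨hne, hy⟩
          rw [hE] at this
          simp at this
        simp [this]
    · obtain ⟨q, hq, hmin⟩ := Finset.exists_min_image (S.erase p) (fun x => Finsupp.degree x)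
        (Finset.nonempty_iff_ne_empty.2 hE)
      have hqS := (Finset.mem_erase.1 hq).2
      have hqp := (Finset.mem_erase.1 hq).1
      have hqle : ∀ x ∈ S.erase p, sgLE α q x := by
        intro x hx
        by_cases hxq : q = x
        · exact ⟨0, zero_mem _, by rw [hxq, add_zero]⟩
        rcases hch hqS (Finset.mem_erase.1 hx).2 hxq with h | ⟨δ, hδ, h⟩
        · exact h
        · have h1 := hmin x hx
          rw [← h, map_add] at h1
          have h2 : δ = 0 := (Finsupp.degree_eq_zero_iff _).1 (by omega)
          rw [h2, add_zero] at h
          exact absurd h.symm hxq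
      have hyp : y ≠ p := by
        intro h
        have h1 := (hS q hqS).2
        rw [h] at h1
        exact hqp (sgLE_antisymm h1 (hS q hqS).1)
      obtain ⟨δ, hδ, hpq⟩ := (hS q hqS).1
      obtain ⟨m, hm, rfl⟩ := D.ex δ hδ
      have hm0 : m ≠ 0 := by
        rintro rfl
        rw [map_zero, add_zero] at hpq
        exact hqp hpq.symm
      obtain ⟨Q, hQ, hQS, hQy⟩ := ih (S.erase p) q y (by rw [Finset.card_erase_of_mem hp]; omega) hq
        (Finset.mem_erase.2 ⟨hyp, hy⟩)
        (fun x hx => ⟨hqle x hx, (hS x (Finset.mem_erase.1 hx).2).2⟩)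
        (hch.mono (Finset.coe_subset.mpr (Finset.erase_subset _ _)))
      refine ⟨m :: Q, ?_, ?_, ?_⟩
      · intro x hx
        rcases List.mem_cons.1 hx with rfl | hx
        · exact ⟨hm0, hm⟩
        · exact hQ x hx
      · rw [ch, hpq, hQS, Finset.insert_erase hp]
      · rw [List.sum_cons, map_add, ← add_assoc, hpq, hQy]

/-- general merges -/
inductive GM (α : Fin n → M e) (J : Fin n → Fin n → Prop) : List (Mo n) → List (Mo n) → Prop
  | head (a b c : Mo n) (L : List (Mo n)) (hc : Cq J c) (h : cont α c = cont α a + cont α b) :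
      GM α J (a :: b :: L) (c :: L)
  | cons (a : Mo n) (L L' : List (Mo n)) (h : GM α J L L') : GM α J (a :: L) (a :: L')

lemma wf_cons {m : Mo n} {Q : List (Mo n)} : WF J (m :: Q) ↔ (m ≠ 0 ∧ Cq J m) ∧ WF J Q := by
  simp [WF]

lemma CMerge.gm {Q Q' : List (Mo n)} (h : CMerge Q Q') (hQ : WF J Q') : GM α J Q Q' := by
  induction h with
  | head a b L => exact GM.head _ _ _ _ (wf_cons.1 hQ).1.2 (map_add _ _ _)
  | cons a L L' h ih => exact GM.cons _ _ _ (ih (wf_cons.1 hQ).2)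

lemma GM.cases_sum (D : Dat α J ord) (hord : IsTermOrder ord) {Q Q' : List (Mo n)}
    (h : GM α J Q Q') : (CMerge Q Q' ∧ Q'.sum = Q.sum) ∨
      (Q'.sum ≠ Q.sum ∧ ord.le Q'.sum Q.sum) := by
  induction h with
  | head a b c L hc h =>
    by_cases he : c = a + b
    · subst he
      exact Or.inl ⟨CMerge.head _ _ _, by simp [add_assoc]⟩
    · right
      have h1 := D.min c (a + b) hc (by rw [map_add, h])
      have h2 := hord.2 _ _ L.sum h1
      simp only [List.sum_cons, ← add_assoc]
      exact ⟨fun h => he (add_right_cancel h), h2⟩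
  | cons a L L' h ih =>
    rcases ih with ⟨h1, h2⟩ | ⟨h1, h2⟩
    · exact Or.inl ⟨CMerge.cons _ _ _ h1, by simp [h2]⟩
    · right
      have h3 := hord.2 _ _ a h2
      simp only [List.sum_cons]
      rw [add_comm a, add_comm a]
      exact ⟨fun h => h1 (add_right_cancel h), h3⟩

lemma GM.degree_le (D : Dat α J ord) {Q Q' : List (Mo n)}
    (h : GM α J Q Q') : Finsupp.degree Q.sum ≤ Finsupp.degree Q'.sum := by
  induction h with
  | head a b c L hc h =>
    have h1 := D.deg c (a + b) hc (by rw [map_add, h])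
    simp only [List.sum_cons, map_add] at h1 ⊢
    omega
  | cons a L L' h ih =>
    simp only [List.sum_cons, map_add]
    omega

lemma ch_erase (D : Dat α J ord) (Q : List (Mo n)) : ∀ (p v : M e), WF J Q → v ∈ ch α p Q → v ≠ p →
    v ≠ p + cont α Q.sum → ∃ Q', GM α J Q Q' ∧ WF J Q' ∧ ch α p Q' = (ch α p Q).erase v := by
  induction Q with
  | nil =>
    intro p v _ hv hp
    exact absurd (by simpa [ch] using hv) hp
  | cons m R ih =>
    intro p v hQ hv hp he
    have hv' : v ∈ ch α (p + cont α m) R := (Finset.mem_insert.1 hv).resolve_left hp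
    obtain ⟨⟨hm0, hm⟩, hR⟩ := wf_cons.1 hQ
    by_cases hvm : v = p + cont α m
    · cases R with
      | nil => simp [hvm] at he
      | cons b L =>
        obtain ⟨⟨hb0, hb⟩, hL⟩ := wf_cons.1 hR
        obtain ⟨c, hc, hcc⟩ := D.ex (cont α m + cont α b) (add_mem (cont_mem _ _) (cont_mem _ _))
        have hc0 : c ≠ 0 := by
          rintro rfl
          rw [map_zero] at hcc
          exact hm0 (D.cont0 _ (add_eq_zero.1 hcc.symm).1)
        refine ⟨c :: L, GM.head _ _ _ _ hc hcc, wf_cons.2 ⟨⟨hc0, hc⟩, hL⟩, ?_⟩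
        rw [ch, ch, ch, Finset.erase_insert_of_ne (Ne.symm hp), hcc, ← add_assoc, ← hvm,
          Finset.erase_insert (ch_notMem D v hb0 L)]
    · obtain ⟨Q', h1, h2, h3⟩ := ih _ v hR hv' hvm (by
        rwa [List.sum_cons, map_add, ← add_assoc] at he)
      refine ⟨m :: Q', GM.cons _ _ _ h1, wf_cons.2 ⟨⟨hm0, hm⟩, h2⟩, ?_⟩
      rw [ch, ch, h3, Finset.erase_insert_of_ne (Ne.symm hp)]

lemma GM.erase (D : Dat α J ord) {Q Q' : List (Mo n)} (h : GM α J Q Q') : WF J Q → ∀ p : M e,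
    ∃ v ∈ ch α p Q, v ≠ p ∧ v ≠ p + cont α Q.sum ∧ ch α p Q' = (ch α p Q).erase v := by
  induction h with
  | head a b c L hc h =>
    intro hQ p
    obtain ⟨⟨ha0, ha⟩, hR⟩ := wf_cons.1 hQ
    obtain ⟨⟨hb0, hb⟩, hL⟩ := wf_cons.1 hR
    have hne : p + cont α a ≠ p := by
      intro h0
      have h1 : p + cont α a = p + 0 := by rw [add_zero]; exact h0
      exact ha0 (D.cont0 _ (add_left_cancel h1))
    refine ⟨p + cont α a, ?_, hne, ?_, ?_⟩
    · exact Finset.mem_insert_of_mem (ch_start _ _)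
    · intro h0
      rw [List.sum_cons, map_add] at h0
      have h1 : cont α a + 0 = cont α a + cont α (b :: L).sum := by
        rw [add_zero]; exact add_left_cancel h0
      have h2 := D.cont0 _ (add_left_cancel h1).symm
      rw [List.sum_cons] at h2
      exact hb0 (add_eq_zero.1 h2).1
    · rw [ch, ch, ch, Finset.erase_insert_of_ne (Ne.symm hne), h, ← add_assoc,
          Finset.erase_insert (ch_notMem D _ hb0 L)]
  | cons a L L' h ih =>
    intro hQ p
    obtain ⟨⟨ha0, ha⟩, hR⟩ := wf_cons.1 hQ
    obtain ⟨v, h1, h2, h3, h4⟩ := ih hR (p + cont α a)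
    have hvp : v ≠ p := by
      rintro rfl
      exact ch_notMem D v ha0 L h1
    refine ⟨v, Finset.mem_insert_of_mem h1, hvp, ?_, ?_⟩
    · rwa [List.sum_cons, map_add, ← add_assoc]
    · rw [ch, ch, h4, Finset.erase_insert_of_ne (Ne.symm hvp)]

end Chains

section Diff
open ASG
variable {e n : ℕ} {α : Fin n → M e} {K : Type} [Field K] {y : M e}

lemma tbd_coeff (i : ℕ) (S : BFace α y i) (T : BFace α y (i - 1)) :
    (tbd K α y i (single S 1)) T ≠ 0 ↔ ∃ v ∈ S.1, v ≠ 0 ∧ v ≠ y ∧ T.1 = S.1.erase v := by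
  have e1 : tbd K α y i (single S 1) = ∑ v ∈ S.1.attach,
      if h : v.1 ≠ 0 ∧ v.1 ≠ y then
        ((-1 : K) ^ (S.1.filter fun w => sgLT α w v.1).card) •
          Finsupp.single (erasedBFace S v.1 v.2 h.1 h.2) 1
      else 0 := by
    rw [tbd, Finsupp.linearCombination_single, one_smul]
  have ee : ∀ (v : S.1) (h : v.1 ≠ 0 ∧ v.1 ≠ y), T.1 ≠ S.1.erase v.1 →
      erasedBFace S v.1 v.2 h.1 h.2 ≠ T := by
    intro v h hne he
    exact hne (by rw [← he]; rfl)
  rw [e1, Finsupp.finsetSum_apply]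
  constructor
  · intro h
    by_contra hcon
    apply h
    apply Finset.sum_eq_zero
    intro v _
    by_cases hv : v.1 ≠ 0 ∧ v.1 ≠ y
    · rw [dif_pos hv, Finsupp.smul_apply, Finsupp.single_apply,
        if_neg (ee v hv fun hT => hcon ⟨v.1, v.2, hv.1, hv.2, hT⟩), smul_zero]
    · rw [dif_neg hv]; rfl
  · rintro ⟨v, hv, h0, hy, hT⟩
    rw [Finset.sum_eq_single ⟨v, hv⟩]
    · rw [dif_pos ⟨h0, hy⟩, Finsupp.smul_apply]
      have : erasedBFace S v hv h0 hy = T := Subtype.ext hT.symm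
      rw [this, Finsupp.single_eq_same, smul_eq_mul, mul_one]
      exact pow_ne_zero _ (neg_ne_zero.2 one_ne_zero)
    · intro w _ hne
      by_cases hw : w.1 ≠ 0 ∧ w.1 ≠ y
      · rw [dif_pos hw, Finsupp.smul_apply, Finsupp.single_apply, if_neg, smul_zero]
        apply ee w hw
        intro hTw
        rw [hT] at hTw
        have : v ∉ S.1.erase w.1 := by rw [← hTw]; simp
        apply this
        exact Finset.mem_erase.2 ⟨fun h => hne (Subtype.ext h.symm), hv⟩
      · rw [dif_neg hw]; rfl
    · intro h
      exact absurd (Finset.mem_attach _ _) h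

/-- the sign -/
def sgn (K : Type) [Field K] (α : Fin n → M e) (S : Finset (M e)) (v : M e) : K :=
  (-1 : K) ^ (S.filter fun w => sgLT α w v).card

/-- internal vertices -/
def inn (y : M e) (S : Finset (M e)) : Finset (M e) := S.filter fun v => v ≠ 0 ∧ v ≠ y

/-- the raw differential on finite sets -/
def rawD (K : Type) [Field K] (α : Fin n → M e) (y : M e) :
    (Finset (M e) →₀ K) →ₗ[K] (Finset (M e) →₀ K) :=
  Finsupp.linearCombination K fun S => ∑ v ∈ inn y S, sgn K α S v • single (S.erase v) 1

lemma rawD_single (S : Finset (M e)) :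
    rawD K α y (single S 1) = ∑ v ∈ inn y S, sgn K α S v • single (S.erase v) 1 := by
  rw [rawD, Finsupp.linearCombination_single, one_smul]

/-- forget the face structure -/
def emb (K : Type) [Field K] (α : Fin n → M e) (y : M e) (i : ℕ) :
    TC K α y i →ₗ[K] (Finset (M e) →₀ K) := Finsupp.lmapDomain K K fun S : BFace α y i => S.1

lemma emb_inj (i : ℕ) : Function.Injective (emb K α y i) :=
  Finsupp.mapDomain_injective Subtype.val_injective

lemma emb_single (i : ℕ) (S : BFace α y i) : emb K α y i (single S 1) = single S.1 1 := by
  simp [emb, Finsupp.lmapDomain_apply, Finsupp.mapDomain_single]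

lemma emb_tbd (i : ℕ) (x : TC K α y i) : emb K α y (i - 1) (tbd K α y i x) = rawD K α y (emb K α y i x) := by
  have : (emb K α y (i - 1)) ∘ₗ tbd K α y i = rawD K α y ∘ₗ emb K α y i := by
    apply Finsupp.lhom_ext'
    intro S
    apply LinearMap.ext_ring
    simp only [LinearMap.comp_apply, Finsupp.lsingle_apply]
    rw [emb_single, rawD_single, tbd, Finsupp.linearCombination_single, one_smul, map_sum, inn,
      Finset.sum_filter, ← Finset.sum_attach S.1]
    refine Finset.sum_congr rfl fun v _ => ?_
    by_cases hv : v.1 ≠ 0 ∧ v.1 ≠ y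
    · rw [dif_pos hv, if_pos hv, map_smul, emb_single]
      rfl
    · rw [dif_neg hv, if_neg hv, map_zero]
  exact LinearMap.congr_fun this x

lemma sgn_erase_lt {S : Finset (M e)} {v w : M e} (hv : v ∈ S) (h : sgLT α v w) :
    sgn K α (S.erase v) w = - sgn K α S w := by
  unfold sgn
  rw [Finset.filter_erase]
  have hm : v ∈ S.filter fun x => sgLT α x w := Finset.mem_filter.2 ⟨hv, h⟩
  rw [← Finset.card_erase_add_one hm, pow_succ]
  simp

lemma sgn_erase_gt {S : Finset (M e)} {v w : M e} (h : sgLT α v w) :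
    sgn K α (S.erase w) v = sgn K α S v := by
  unfold sgn
  rw [Finset.filter_erase, Finset.erase_eq_of_notMem]
  intro hm
  have := (Finset.mem_filter.1 hm).2
  exact h.2 (sgLE_antisymm h.1 this.1)

lemma rawD_sq {S : Finset (M e)} (hS : (S : Set (M e)).Pairwise (cmp2 α)) :
    rawD K α y (rawD K α y (single S 1)) = 0 := by
  rw [rawD_single, map_sum]
  simp only [map_smul, rawD_single, Finset.smul_sum, smul_smul]
  rw [Finset.sum_sigma']
  refine Finset.sum_involution (fun p _ => ⟨p.2, p.1⟩) ?_ ?_ ?_ ?_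
  · rintro ⟨v, w⟩ hp
    simp only [Finset.mem_sigma, inn, Finset.mem_filter, Finset.mem_erase] at hp
    obtain ⟨⟨hv, hv'⟩, ⟨hwv, hw⟩, hw'⟩ := hp
    simp only
    rw [Finset.erase_right_comm (a := w) (b := v), ← add_smul]
    have : sgn K α S v * sgn K α (S.erase v) w + sgn K α S w * sgn K α (S.erase w) v = 0 := by
      rcases hS hv hw (Ne.symm hwv) with h | h
      · have h' : sgLT α v w := ⟨h, Ne.symm hwv⟩
        rw [sgn_erase_lt hv h', sgn_erase_gt h']; ring
      · have h' : sgLT α w v := ⟨h, hwv⟩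
        rw [sgn_erase_lt hw h', sgn_erase_gt h']; ring
    rw [this, zero_smul]
  · rintro ⟨v, w⟩ hp _ he
    simp only [Finset.mem_sigma, inn, Finset.mem_filter, Finset.mem_erase] at hp
    simp only [Sigma.mk.injEq] at he
    exact hp.2.1.1 he.1
  · rintro ⟨v, w⟩ hp
    simp only [Finset.mem_sigma, inn, Finset.mem_filter, Finset.mem_erase] at hp ⊢
    obtain ⟨⟨hv, hv'⟩, ⟨hwv, hw⟩, hw'⟩ := hp
    exact ⟨⟨hw, hw'⟩, ⟨Ne.symm hwv, hv⟩, hv'⟩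
  · rintro ⟨v, w⟩ hp
    rfl

lemma tbd_sq (i : ℕ) (x : TC K α y (i + 1)) : tbd K α y i (tbd K α y (i + 1) x) = 0 := by
  apply emb_inj (K := K) (α := α) (y := y) (i - 1)
  rw [emb_tbd, map_zero]
  have h1 : emb K α y i (tbd K α y (i + 1) x) = rawD K α y (emb K α y (i+1) x) := emb_tbd (i+1) x
  rw [h1]
  have : rawD K α y ∘ₗ rawD K α y ∘ₗ emb K α y (i+1) = 0 := by
    apply Finsupp.lhom_ext'
    intro S
    apply LinearMap.ext_ring
    simp only [LinearMap.comp_apply, Finsupp.lsingle_apply, LinearMap.zero_apply]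
    rw [emb_single, rawD_sq S.2.1.2.2.2]
  exact LinearMap.congr_fun this x

end Diff
end ASGM

namespace ASGM
open Finsupp

section Assembly
open ASG
variable {e n : ℕ} {α : Fin n → M e} {J : Fin n → Fin n → Prop} {ord : LinearOrder (Fin n →₀ ℕ)}
  {lam : M e} {K : Type} [Field K]

lemma sgLE_le {x y : M e} (h : sgLE α x y) : x ≤ y := by
  obtain ⟨d, _, rfl⟩ := h
  exact le_self_add

instance finite_BFace (i : ℕ) : Finite (BFace α lam i) := by
  let f : BFace α lam i → {S : Finset (M e) // S ∈ (Finset.Iic lam).powerset} := fun S =>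
    ⟨S.1, Finset.mem_powerset.2 fun x hx => Finset.mem_Iic.2 (sgLE_le (S.2.1.1 x hx).2)⟩
  refine Finite.of_injective f fun S T h => ?_
  exact Subtype.ext (congrArg (fun z => z.1) h)

lemma exists_toL (D : Dat α J ord) {i : ℕ} (S : BFace α lam i) :
    ∃ Q : List (Mo n), WF J Q ∧ ch α 0 Q = S.1 ∧ cont α Q.sum = lam := by
  obtain ⟨Q, h1, h2, h3⟩ := ch_surj D (i+1) S.1 0 lam S.2.2 S.2.1.2.1 S.2.1.2.2.1
    (fun μ hμ => ⟨⟨μ, (S.2.1.1 μ hμ).1, zero_add _⟩, (S.2.1.1 μ hμ).2⟩) S.2.1.2.2.2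
  exact ⟨Q, h1, h2, by rwa [zero_add] at h3⟩

/-- the list of standard monomials attached to a chain -/
def toL (D : Dat α J ord) {i : ℕ} (S : BFace α lam i) : List (Mo n) := (exists_toL D S).choose

lemma toL_wf (D : Dat α J ord) {i : ℕ} (S : BFace α lam i) : WF J (toL D S) :=
  (exists_toL D S).choose_spec.1

lemma toL_ch (D : Dat α J ord) {i : ℕ} (S : BFace α lam i) : ch α 0 (toL D S) = S.1 :=
  (exists_toL D S).choose_spec.2.1

lemma toL_sum (D : Dat α J ord) {i : ℕ} (S : BFace α lam i) : cont α (toL D S).sum = lam :=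
  (exists_toL D S).choose_spec.2.2

lemma toL_length (D : Dat α J ord) {i : ℕ} (S : BFace α lam i) : (toL D S).length = i := by
  have h := ch_card D (toL D S) 0 fun m hm => (toL_wf D S m hm).1
  rw [toL_ch, S.2.2] at h
  omega

lemma toL_inj (D : Dat α J ord) {i : ℕ} {S T : BFace α lam i} (h : toL D S = toL D T) : S = T := by
  apply Subtype.ext
  rw [← toL_ch D S, h, toL_ch]

lemma exists_face (D : Dat α J ord) {i : ℕ} {Q : List (Mo n)} (h : WF J Q)
    (hs : cont α Q.sum = lam) (hl : Q.length = i) : ∃ S : BFace α lam i, toL D S = Q := by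
  refine ⟨⟨ch α 0 Q, ⟨⟨fun μ hμ => ⟨?_, ?_⟩, ch_start _ _, ?_, ?_⟩, ?_⟩⟩, ?_⟩
  · obtain ⟨m, rfl⟩ := ch_ge Q 0 μ hμ
    rw [zero_add]
    exact cont_mem _ _
  · have := ch_le Q 0 μ hμ
    rwa [zero_add, hs] at this
  · have := ch_end (α := α) Q 0
    rwa [zero_add, hs] at this
  · exact fun x hx y hy _ => ch_chain Q 0 x hx y hy
  · rw [ch_card D Q 0 fun m hm => (h m hm).1, hl]
  · exact ch_inj D _ 0 _ (toL_wf D _) h (toL_ch D _)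

lemma coeff_gm (D : Dat α J ord) (i : ℕ) (S : BFace α lam i) (T : BFace α lam (i - 1)) :
    (tbd K α lam i (single S 1)) T ≠ 0 ↔ GM α J (toL D S) (toL D T) := by
  rw [tbd_coeff]
  constructor
  · rintro ⟨v, hv, h0, hy, hT⟩
    rw [← toL_ch D S] at hv
    obtain ⟨Q', h1, h2, h3⟩ := ch_erase D (toL D S) 0 v (toL_wf D S) hv h0
      (by rw [zero_add, toL_sum]; exact hy)
    have : Q' = toL D T := ch_inj D _ 0 _ h2 (toL_wf D T) (by rw [h3, toL_ch, toL_ch, hT])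
    rwa [← this]
  · intro h
    obtain ⟨v, hv, h0, hy, hT⟩ := h.erase D (toL_wf D S) 0
    rw [toL_ch] at hv
    rw [zero_add, toL_sum] at hy
    rw [toL_ch, toL_ch] at hT
    exact ⟨v, hv, h0, hy, hT⟩

/-- the initial state of the matching -/
def P0 (n : ℕ) : Fin n → Prop := fun _ => True

/-- top cells -/
def cA (D : Dat α J ord) (lam : M e) (i : ℕ) : Set (BFace α lam i) :=
  {S | ∃ w Q1, Top J (P0 n) w (toL D S) Q1}

/-- bottom cells -/
def cB (D : Dat α J ord) (lam : M e) (i : ℕ) : Set (BFace α lam i) :=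
  {S | ∃ w Q0, Top J (P0 n) w Q0 (toL D S)}

/-- critical cells -/
def cC (D : Dat α J ord) (lam : M e) (i : ℕ) : Set (BFace α lam i) :=
  {S | ∃ v, crit J (P0 n) v ∧ toL D S = wcell v}

/-- the matching relation -/
def pr (D : Dat α J ord) (lam : M e) (i : ℕ) (S : BFace α lam (i+1)) (T : BFace α lam i) : Prop :=
  ∃ w, Top J (P0 n) w (toL D S) (toL D T)

/-- word attached to a top cell -/
def wd (J : Fin n → Fin n → Prop) (Q : List (Mo n)) : List (Fin n) :=
  if h : ∃ w Q', Top J (P0 n) w Q Q' then h.choose else []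

lemma wd_eq {w Q Q'} (h : Top J (P0 n) w Q Q') : wd J Q = w := by
  have hh : ∃ w Q', Top J (P0 n) w Q Q' := ⟨w, Q', h⟩
  rw [wd, dif_pos hh]
  obtain ⟨Q2, h2⟩ := hh.choose_spec
  exact (h2.func h).2

/-- the order used for acyclicity -/
def RR (ord : LinearOrder (Fin n →₀ ℕ)) (J : Fin n → Fin n → Prop) (Q Q' : List (Mo n)) : Prop :=
  (Q.sum ≠ Q'.sum ∧ ord.le Q.sum Q'.sum) ∨ (Q.sum = Q'.sum ∧ wd J Q' < wd J Q)

lemma RR_irrefl (Q : List (Mo n)) : ¬ RR ord J Q Q := by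
  rintro (⟨h, _⟩ | ⟨_, h⟩)
  · exact h rfl
  · exact lt_irrefl _ h

lemma RR_trans {Q Q' Q'' : List (Mo n)} (h : RR ord J Q Q') (h' : RR ord J Q' Q'') :
    RR ord J Q Q'' := by
  rcases h with ⟨h1, h2⟩ | ⟨h1, h2⟩ <;> rcases h' with ⟨h3, h4⟩ | ⟨h3, h4⟩
  · left
    refine ⟨fun he => h1 ?_, ord.le_trans _ _ _ h2 h4⟩
    rw [← he] at h4
    exact ord.le_antisymm _ _ h2 h4
  · left; rw [← h3]; exact ⟨h1, h2⟩
  · left; rw [h1]; exact ⟨h3, h4⟩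
  · right; exact ⟨h1.trans h3, h4.trans h2⟩

lemma cover (D : Dat α J ord) (i : ℕ) (S : BFace α lam i) :
    S ∈ cA D lam i ∨ S ∈ cB D lam i ∨ S ∈ cC D lam i := by
  refine trich J (toL D S) (P0 n) (toL_wf D S) ?_
  intro m L hm
  have h0 : m ≠ 0 := (toL_wf D S m (by rw [hm]; simp)).1
  obtain ⟨z, hz⟩ := Finsupp.ne_iff.1 h0
  exact ⟨z, hz, trivial⟩

lemma cA_zero (D : Dat α J ord) (S : BFace α lam 0) : S ∉ cA D lam 0 := by
  rintro ⟨w, Q', h⟩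
  obtain ⟨y, L, _, hQ⟩ := h.head
  have := toL_length D S
  rw [hQ] at this
  simp at this

lemma A_pr (D : Dat α J ord) (hs : ∀ a b, J a b → J b a) (i : ℕ) (S : BFace α lam (i+1))
    (hS : S ∈ cA D lam (i+1)) : ∃ T, pr D lam i S T := by
  obtain ⟨w, Q', h⟩ := hS
  have h1 := h.cmerge.sum
  have h2 := h.cmerge.length
  rw [toL_length] at h2
  obtain ⟨T, hT⟩ := exists_face (lam := lam) (i := i) D (h.wf_bot hs (toL_wf D S))
    (by rw [← h1, toL_sum]) (by omega)
  exact ⟨T, w, by rwa [hT]⟩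

lemma B_pr (D : Dat α J ord) (i : ℕ) (T : BFace α lam i)
    (hT : T ∈ cB D lam i) : ∃ S ∈ cA D lam (i+1), pr D lam i S T := by
  obtain ⟨w, Q, h⟩ := hT
  have h1 := h.cmerge.sum
  have h2 := h.cmerge.length
  rw [toL_length] at h2
  obtain ⟨S, hS⟩ := exists_face (lam := lam) (i := i+1) D (h.wf_top (toL_wf D T))
    (by rw [h1, toL_sum]) (by omega)
  have h' : Top J (P0 n) w (toL D S) (toL D T) := by rwa [hS]
  exact ⟨S, ⟨w, _, h'⟩, w, h'⟩

lemma pr_fun (D : Dat α J ord) (i : ℕ) (S : BFace α lam (i+1)) (T T' : BFace α lam i)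
    (h : pr D lam i S T) (h' : pr D lam i S T') : T = T' := by
  obtain ⟨w, h⟩ := h
  obtain ⟨w', h'⟩ := h'
  exact toL_inj D (h.func h').1

lemma pr_inj (D : Dat α J ord) (i : ℕ) (S S' : BFace α lam (i+1)) (T : BFace α lam i)
    (h : pr D lam i S T) (h' : pr D lam i S' T) : S = S' := by
  obtain ⟨w, h⟩ := h
  obtain ⟨w', hh⟩ := h'
  exact toL_inj D (h.inj hh)

/-- the differential with target index reduced -/
def dd (K : Type) [Field K] (α : Fin n → M e) (lam : M e) (i : ℕ) :
    (BFace α lam (i+1) →₀ K) →ₗ[K] (BFace α lam i →₀ K) := tbd K α lam (i+1)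

lemma dd_coeff (D : Dat α J ord) (i : ℕ) (S : BFace α lam (i+1)) (T : BFace α lam i) :
    (dd K α lam i (single S 1)) T ≠ 0 ↔ GM α J (toL D S) (toL D T) :=
  coeff_gm D (i+1) S T

lemma wcell_degree (v : List (Fin n)) : Finsupp.degree (wcell v).sum = v.length := by
  induction v with
  | nil => simp [wcell]
  | cons a v ih =>
    have : (wcell (a :: v)).sum = single a 1 + (wcell v).sum := by simp [wcell]
    rw [this, map_add, ih]
    simp [add_comm]

lemma rank_dd (D : Dat α J ord) (hord : IsTermOrder ord) (hs : ∀ a b, J a b → J b a) (i : ℕ) :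
    Module.finrank K (LinearMap.range (dd K α lam i)) = Nat.card (cA D lam (i+1)) := by
  refine morse_rank (fun i => BFace α lam i) (dd K α lam) ?_ (cA D lam) (cB D lam) (cC D lam)
    (cover D) (cA_zero D) (pr D lam) (A_pr D hs) (B_pr D) (pr_fun D)
    (fun i S T => RR ord J (toL D S) (toL D T)) (fun i a b c h h' => RR_trans h h')
    (fun i a => RR_irrefl _) ?_ ?_ (fun i S => Finsupp.degree (toL D S).sum) ?_ ?_ ?_ i
  · intro j x
    exact tbd_sq (j+1) x
  · rintro j S T ⟨w, h⟩
    exact (dd_coeff D j S T).2 (h.cmerge.gm (toL_wf D T))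
  · rintro j S T ⟨w, h⟩ S' ⟨w', Q', h'⟩ hne hc
    have hc' := (dd_coeff D j S' T).1 hc
    have e1 := h.cmerge.sum
    rcases hc'.cases_sum D hord with ⟨h1, h2⟩ | ⟨h1, h2⟩
    · right
      refine ⟨by rw [e1, h2], ?_⟩
      rw [wd_eq h, wd_eq h']
      exact acyclic h h' (fun m hm => (toL_wf D S' m hm).1) h1 fun hh => hne (toL_inj D hh)
    · left
      rw [e1]
      exact ⟨h1, h2⟩
  · intro j S T h
    exact ((dd_coeff D j S T).1 h).degree_le D
  · rintro j S T ⟨w, h⟩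
    exact le_of_eq (by rw [h.cmerge.sum])
  · rintro j S ⟨v, hv, h⟩
    have hl := toL_length D S
    rw [h] at hl
    show Finsupp.degree (toL D S).sum = j
    rw [h, wcell_degree]
    simpa [wcell] using hl

lemma card_AB (D : Dat α J ord) (hs : ∀ a b, J a b → J b a) (i : ℕ) :
    Nat.card (cA D lam (i+1)) = Nat.card (cB D lam i) := by
  let f : cA D lam (i+1) → cB D lam i := fun S =>
    ⟨(A_pr D hs i S.1 S.2).choose, (A_pr D hs i S.1 S.2).choose_spec.choose, _,
      (A_pr D hs i S.1 S.2).choose_spec.choose_spec⟩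
  have hf : ∀ S, pr D lam i S.1 (f S).1 := fun S => (A_pr D hs i S.1 S.2).choose_spec
  refine Nat.card_congr (Equiv.ofBijective f ⟨fun S S' h => ?_, fun T => ?_⟩)
  · have h1 := hf S
    rw [h] at h1
    exact Subtype.ext (pr_inj D i _ _ _ h1 (hf S'))
  · obtain ⟨S, hS, h⟩ := B_pr D i T.1 T.2
    exact ⟨⟨S, hS⟩, Subtype.ext (pr_fun D i S _ _ (hf ⟨S, hS⟩) h)⟩

lemma card_total (D : Dat α J ord) (i : ℕ) : Nat.card (BFace α lam i) =
    Nat.card (cA D lam i) + Nat.card (cB D lam i) + Nat.card (cC D lam i) := by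
  have h1 : Disjoint (cA D lam i) (cB D lam i) := Set.disjoint_left.2 fun S hA hB => by
    obtain ⟨w, Q', h⟩ := hA
    obtain ⟨w2, Q2, h2⟩ := hB
    exact h.not_bot h2
  have h2 : Disjoint (cA D lam i ∪ cB D lam i) (cC D lam i) := Set.disjoint_left.2 fun S hA hC => by
    obtain ⟨v, hv, hC⟩ := hC
    rcases hA with ⟨w, Q', h⟩ | ⟨w, Q', h⟩
    · exact h.not_crit hv hC
    · exact h.not_crit' hC
  have h3 : (cA D lam i ∪ cB D lam i) ∪ cC D lam i = Set.univ := by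
    ext S
    have := cover D i S
    simp only [Set.mem_union, Set.mem_univ, iff_true]
    tauto
  rw [← Set.ncard_univ, ← h3, Set.ncard_union_eq h2 (Set.toFinite _) (Set.toFinite _),
    Set.ncard_union_eq h1 (Set.toFinite _) (Set.toFinite _)]
  rfl

lemma wcell_wf (D : Dat α J ord) (v : List (Fin n)) : WF J (wcell v) := by
  intro m hm
  obtain ⟨y, _, rfl⟩ := List.mem_map.1 hm
  refine ⟨by simp, fun a b h => ?_⟩
  have := Finsupp.degree_mono h
  simp at this

lemma wcell_cont (v : List (Fin n)) : cont α (wcell v).sum = (v.map α).sum := by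
  induction v with
  | nil => simp [wcell]
  | cons a v ih =>
    have : (wcell (a :: v)).sum = single a 1 + (wcell v).sum := by simp [wcell]
    rw [this, map_add, ih, cont_single]
    simp

lemma wcell_inj {v w : List (Fin n)} (h : wcell v = wcell w) : v = w :=
  List.map_injective_iff.2 (fun _ _ h => single_inj' h) h

lemma card_C (D : Dat α J ord) (hs : ∀ a b, J a b → J b a) (i : ℕ) : Nat.card (cC D lam i) =
    Nat.card {v : List (Fin n) // Norm J v ∧ v.length = i ∧ (v.map α).sum = lam} := by
  let f : cC D lam i → {v : List (Fin n) // Norm J v ∧ v.length = i ∧ (v.map α).sum = lam} :=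
    fun S => ⟨S.2.choose, (crit_iff.1 S.2.choose_spec.1).2, by
      have h := toL_length D S.1
      rw [S.2.choose_spec.2] at h
      simpa [wcell] using h, by
      have h := toL_sum D S.1
      rw [S.2.choose_spec.2] at h
      rwa [wcell_cont] at h⟩
  have hf : ∀ S, toL D S.1 = wcell (f S).1 := fun S => S.2.choose_spec.2
  refine Nat.card_congr (Equiv.ofBijective f ⟨fun S S' h => ?_, fun v => ?_⟩)
  · apply Subtype.ext
    apply toL_inj D
    rw [hf, hf, h]
  · obtain ⟨v, hv, hl, hc⟩ := v
    obtain ⟨S, hS⟩ := exists_face (lam := lam) (i := i) D (wcell_wf D v) (by rw [wcell_cont, hc])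
      (by simpa [wcell] using hl)
    refine ⟨⟨S, v, crit_iff.2 ⟨fun _ _ _ => trivial, hv⟩, hS⟩, ?_⟩
    apply Subtype.ext
    apply wcell_inj
    rw [← hf, hS]

lemma rank_tbd (D : Dat α J ord) (hord : IsTermOrder ord) (hs : ∀ a b, J a b → J b a) (i : ℕ) :
    Module.finrank K (LinearMap.range (tbd K α lam i)) = Nat.card (cA D lam i) := by
  cases i with
  | zero =>
    have h0 : tbd K α lam 0 = 0 := by
      apply Finsupp.lhom_ext'
      intro S
      apply LinearMap.ext_ring
      ext T
      by_contra hne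
      have hne' : (tbd K α lam 0 (single S 1)) T ≠ 0 := by simpa using hne
      obtain ⟨v, hv, h1, h2, _⟩ := (tbd_coeff 0 S T).1 hne'
      exact h1 (Finset.card_le_one.1 (le_of_eq S.2.2) v hv 0 S.2.1.2.1)
    have : IsEmpty (cA D lam 0) := ⟨fun S => cA_zero D S.1 S.2⟩
    rw [h0, LinearMap.range_zero, finrank_bot, Nat.card_of_isEmpty]
  | succ i => exact rank_dd D hord hs i

theorem main (D : Dat α J ord) (hord : IsTermOrder ord) (hs : ∀ a b, J a b → J b a) (i : ℕ) :
    Module.finrank K (TorMod K α lam i) =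
      Nat.card {v : List (Fin n) // Norm J v ∧ v.length = i ∧ (v.map α).sum = lam} := by
  have h := finrank_homology (dd K α lam i) (tbd K α lam i) (fun x => tbd_sq i x)
  have hW : Module.finrank K (BFace α lam i →₀ K) = Nat.card (BFace α lam i) := by
    have := Fintype.ofFinite (BFace α lam i)
    rw [Module.finrank_finsupp_self, Nat.card_eq_fintype_card]
  rw [hW, rank_dd D hord hs, rank_tbd D hord hs, card_AB D hs, card_total D, card_C D hs] at h
  have h' : Module.finrank K (TorMod K α lam i) = Module.finrank K
    (Submodule.map (Submodule.mkQ (LinearMap.range (dd K α lam i)))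
      (LinearMap.ker (tbd K α lam i))) := rfl
  omega

end Assembly
end ASGM

open ASG in
/-- Suppose the generators are pairwise distinct, each
generator is irreducible in `Λ`, and `I_Λ` has a Gröbner basis of degree 2
for the field `k`.  Then for every `λ ∈ Λ` and every `i ≥ 0`,
`dim_k Tor_i^{k[Λ]}(k,k)_λ` equals the number of `J'`-non-stuttering
`J'`-commuting equivalence classes of words of length `i` and content `λ`. -/
theorem tor_dimension_counts_word_classes
    (e n : ℕ) (α : Fin n → M e) (hα : ∀ i, α i ≠ 0) (hinj : Function.Injective α)
    (hirr : ∀ i, ¬ ∃ a ∈ sg α, ∃ b ∈ sg α, a ≠ 0 ∧ b ≠ 0 ∧ a + b = α i)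
    (k : Type) [Field k] (ord : LinearOrder (Fin n →₀ ℕ)) (hord : IsTermOrder ord)
    (hGB : HasGB k ord α 2) (lam : M e) (hlam : lam ∈ sg α) (i : ℕ) :
    Module.finrank k (TorMod k α lam i) = classCount k ord α i lam := by
  rw [← ASGM.count_classes]
  exact ASGM.main (ASGM.mkDat hord hα hinj hirr hGB) hord ASGM.Jrel_symm i
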